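/- Under the two-group random mixture model, for any α∈[0,1] there exist constants α1, α2 with 0≤α1≤α≤α2≤1 such that the randomized oracle rule δ^n_OR(α), which equals δ^n_NP(α1) with probability (α2−α)/(α2−α1) and equals δ^n_NP(α2) with probability (α−α1)/(α2−α1) (and equals δ^n_NP(α) if α1=α2=α), satisfies FDR(δ^n_OR(α)) ≤ α for every n and lim_{n→∞} FNR(δ^n_OR(α)) equals the greatest convex minorant of mFNR* evaluated at α. -/

import Mathlib

open MeasureTheory ProbabilityTheory Filter

namespace TwoGroup

/-- The two-group random mixture model: a σ-finite base measure on the sample space `𝒳`,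
a null proportion `π0 ∈ (0,1)`, and null/non-null probability density functions `f0`, `f1`
with respect to the base measure. -/
structure Model (𝒳 : Type*) [MeasurableSpace 𝒳] where
  base : Measure 𝒳
  sigmaFinite : SigmaFinite base
  π0 : ℝ
  π0_mem : π0 ∈ Set.Ioo (0 : ℝ) 1
  f0 : 𝒳 → ℝ
  f1 : 𝒳 → ℝ
  f0_meas : Measurable f0
  f1_meas : Measurable f1
  f0_nonneg : ∀ x, 0 ≤ f0 x
  f1_nonneg : ∀ x, 0 ≤ f1 x
  f0_prob : IsProbabilityMeasure (base.withDensity fun x => ENNReal.ofReal (f0 x))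
  f1_prob : IsProbabilityMeasure (base.withDensity fun x => ENNReal.ofReal (f1 x))

namespace Model

variable {𝒳 : Type*} [MeasurableSpace 𝒳] (M : Model 𝒳)

/-- The non-null proportion `π1 = 1 - π0`. -/
noncomputable def π1 : ℝ := 1 - M.π0

/-- The marginal density `f = π0 f0 + π1 f1`. -/
noncomputable def f (x : 𝒳) : ℝ := M.π0 * M.f0 x + M.π1 * M.f1 x

/-- The local false discovery rate `Lfdr(x) = π0 f0(x) / f(x)`. -/
noncomputable def Lfdr (x : 𝒳) : ℝ := M.π0 * M.f0 x / M.f x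

/-- The joint law of a single pair `(θ, X)`; `true` encodes `θ = 1` (non-null). -/
noncomputable def joint : Measure (Bool × 𝒳) :=
  (ENNReal.ofReal M.π0) •
      ((Measure.dirac false).prod (M.base.withDensity fun x => ENNReal.ofReal (M.f0 x))) +
    (ENNReal.ofReal M.π1) •
      ((Measure.dirac true).prod (M.base.withDensity fun x => ENNReal.ofReal (M.f1 x)))

/-- The joint law of `((θ1, X1), …, (θn, Xn))`: i.i.d. copies of `(θ, X)`. -/
noncomputable def jointN (n : ℕ) : Measure (Fin n → Bool × 𝒳) :=
  Measure.pi fun _ => M.joint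

end Model

/-- Number of rejections `Σ_i δ_i`. -/
def nRej {n : ℕ} (d : Fin n → Bool) : ℝ := ∑ i, if d i then (1 : ℝ) else 0

/-- Number of false discoveries `Σ_i δ_i (1 - θ_i)`. -/
def nFD {n : ℕ} (θ d : Fin n → Bool) : ℝ :=
  ∑ i, (if d i then (1 : ℝ) else 0) * (if θ i then (0 : ℝ) else 1)

/-- Number of acceptances `Σ_i (1 - δ_i)`. -/
def nAcc {n : ℕ} (d : Fin n → Bool) : ℝ := ∑ i, if d i then (0 : ℝ) else 1

/-- Number of false non-discoveries `Σ_i (1 - δ_i) θ_i`. -/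
def nFN {n : ℕ} (θ d : Fin n → Bool) : ℝ :=
  ∑ i, (if d i then (0 : ℝ) else 1) * (if θ i then (1 : ℝ) else 0)

/-- False discovery proportion. -/
noncomputable def FDP {n : ℕ} (θ d : Fin n → Bool) : ℝ := nFD θ d / max 1 (nRej d)

/-- False non-discovery proportion. -/
noncomputable def FNP {n : ℕ} (θ d : Fin n → Bool) : ℝ := nFN θ d / max 1 (nAcc d)

/-- A decision rule is a Markov kernel from `𝒳^n` to `{0,1}^n`: a measurable family of
probability measures on `Fin n → Bool`. -/
def IsRule {𝒳 : Type*} [MeasurableSpace 𝒳] {n : ℕ}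
    (κ : (Fin n → 𝒳) → Measure (Fin n → Bool)) : Prop :=
  Measurable κ ∧ ∀ x, IsProbabilityMeasure (κ x)

namespace Model

variable {𝒳 : Type*} [MeasurableSpace 𝒳] (M : Model 𝒳)

/-- The false discovery rate `FDR = E[FDP]` of a (randomized) decision rule. -/
noncomputable def FDR (n : ℕ) (κ : (Fin n → 𝒳) → Measure (Fin n → Bool)) : ℝ :=
  ∫ ω, ∫ d, FDP (fun i => (ω i).1) d ∂(κ fun i => (ω i).2) ∂(M.jointN n)

/-- The false non-discovery rate `FNR = E[FNP]` of a (randomized) decision rule. -/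
noncomputable def FNR (n : ℕ) (κ : (Fin n → 𝒳) → Measure (Fin n → Bool)) : ℝ :=
  ∫ ω, ∫ d, FNP (fun i => (ω i).1) d ∂(κ fun i => (ω i).2) ∂(M.jointN n)

/-- The marginal FDR `mFDR = E[Σ δi (1-θi)] / E[Σ δi]` (with `0/0 = 0`). -/
noncomputable def mFDR (n : ℕ) (κ : (Fin n → 𝒳) → Measure (Fin n → Bool)) : ℝ :=
  (∫ ω, ∫ d, nFD (fun i => (ω i).1) d ∂(κ fun i => (ω i).2) ∂(M.jointN n)) /
    (∫ ω, ∫ d, nRej d ∂(κ fun i => (ω i).2) ∂(M.jointN n))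

/-- The marginal FNR `mFNR = E[Σ (1-δi) θi] / E[Σ (1-δi)]` (with `0/0 = 0`). -/
noncomputable def mFNR (n : ℕ) (κ : (Fin n → 𝒳) → Measure (Fin n → Bool)) : ℝ :=
  (∫ ω, ∫ d, nFN (fun i => (ω i).1) d ∂(κ fun i => (ω i).2) ∂(M.jointN n)) /
    (∫ ω, ∫ d, nAcc d ∂(κ fun i => (ω i).2) ∂(M.jointN n))

/-- `FNR*_n(α)`: the minimum FNR over decision rules controlling FDR at level `α`. -/
noncomputable def FNRstar (n : ℕ) (α : ℝ) : ℝ :=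
  sInf {r | ∃ κ : (Fin n → 𝒳) → Measure (Fin n → Bool),
    IsRule κ ∧ M.FDR n κ ≤ α ∧ r = M.FNR n κ}

/-- The minimum mFNR over decision rules for `n` hypotheses controlling mFDR at level `α`. -/
noncomputable def mFNRstarN (n : ℕ) (α : ℝ) : ℝ :=
  sInf {r | ∃ κ : (Fin n → 𝒳) → Measure (Fin n → Bool),
    IsRule κ ∧ M.mFDR n κ ≤ α ∧ r = M.mFNR n κ}

/-- `mFNR*(α)` (this quantity does not depend on the number of hypotheses; we take `n = 1`). -/
noncomputable def mFNRstar (α : ℝ) : ℝ := M.mFNRstarN 1 α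

/-- The marginal law of a single observation `X ∼ f`. -/
noncomputable def Pmix : Measure 𝒳 := M.base.withDensity fun x => ENNReal.ofReal (M.f x)

/-- The law of `W = Lfdr(X)`, `X ∼ f`. -/
noncomputable def νW : Measure ℝ := M.Pmix.map M.Lfdr

/-- `G(t) = P(W ≤ t)`. -/
noncomputable def G (t : ℝ) : ℝ := (M.νW (Set.Iic t)).toReal

/-- `Ḡ(t) = P(W < t)`. -/
noncomputable def Gbar (t : ℝ) : ℝ := (M.νW (Set.Iio t)).toReal

/-- The generalized inverse `G^{-1}(u) = inf{t : G(t) ≥ u}`. -/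
noncomputable def Ginv (u : ℝ) : ℝ := sInf {t | u ≤ M.G t}

/-- `P(W = t)`. -/
noncomputable def atom (t : ℝ) : ℝ := (M.νW {t}).toReal

/-- The randomization probability `p(u)`, satisfying
`Ḡ(G^{-1}(u)) + p(u) P(W = G^{-1}(u)) = u`. -/
noncomputable def pu (u : ℝ) : ℝ := (u - M.Gbar (M.Ginv u)) / M.atom (M.Ginv u)

/-- `a(u) = E[W | S_u = 1]` for `u ∈ (0,1]`, `a(0) = 0`, where `S_u` is the Bernoulli(u)
thresholding variable of `W` at `G^{-1}(u)` with randomization `p(u)` at the boundary. -/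
noncomputable def a (u : ℝ) : ℝ :=
  if u = 0 then 0
  else ((∫ w in Set.Iio (M.Ginv u), w ∂M.νW) + M.pu u * (M.Ginv u * M.atom (M.Ginv u))) / u

/-- `b(u) = E[1 - W | S_u = 0]` for `u ∈ [0,1)`, `b(1) = 0`. -/
noncomputable def b (u : ℝ) : ℝ :=
  if u = 1 then 0
  else ((∫ w in Set.Ioi (M.Ginv u), (1 - w) ∂M.νW)
      + (1 - M.pu u) * ((1 - M.Ginv u) * M.atom (M.Ginv u))) / (1 - u)

/-- `b*(α) = inf{b(u) : u ∈ [0,1], a(u) ≤ α}`. -/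
noncomputable def bstar (α : ℝ) : ℝ :=
  sInf {y | ∃ u ∈ Set.Icc (0 : ℝ) 1, M.a u ≤ α ∧ y = M.b u}

/-- `u*(α) = sup{u ∈ [0,1] : a(u) ≤ α}`. -/
noncomputable def ustar (α : ℝ) : ℝ :=
  sSup {u | u ∈ Set.Icc (0 : ℝ) 1 ∧ M.a u ≤ α}

/-- `b**(α) = inf{E[b(U)] : U a [0,1]-valued random variable with E[a(U)] ≤ α}`. -/
noncomputable def bstarstar (α : ℝ) : ℝ :=
  sInf {y | ∃ ρ : Measure ℝ, IsProbabilityMeasure ρ ∧ (∀ᵐ u ∂ρ, u ∈ Set.Icc (0 : ℝ) 1) ∧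
    (∫ u, M.a u ∂ρ) ≤ α ∧ y = ∫ u, M.b u ∂ρ}

end Model

/-- The Bernoulli(p) measure on `Bool`. -/
noncomputable def bern (p : ℝ) : Measure Bool :=
  (ENNReal.ofReal p) • Measure.dirac true + (ENNReal.ofReal (1 - p)) • Measure.dirac false

namespace Model

variable {𝒳 : Type*} [MeasurableSpace 𝒳] (M : Model 𝒳)

/-- The per-observation rejection probability of the Neyman–Pearson rule at level `α`:
reject if `Lfdr(x) < G^{-1}(u*(α))`, randomize with probability `p(u*(α))` at equality,
and accept otherwise. -/
noncomputable def qNP (α : ℝ) (x : 𝒳) : ℝ :=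
  if M.Lfdr x < M.Ginv (M.ustar α) then 1
  else if M.Lfdr x = M.Ginv (M.ustar α) then M.pu (M.ustar α)
  else 0

/-- The Neyman–Pearson rule `δ^n_NP(α)`, as a Markov kernel: independent randomized
likelihood-ratio tests applied to each observation. -/
noncomputable def NP (α : ℝ) (n : ℕ) : (Fin n → 𝒳) → Measure (Fin n → Bool) :=
  fun x => Measure.pi fun i => bern (M.qNP α (x i))

/-- The probability (over data and the randomization of the rule `κ`) that the decision vector
lies in the set `E θ` (which may depend on the true labels `θ`). -/
noncomputable def prob (n : ℕ) (κ : (Fin n → 𝒳) → Measure (Fin n → Bool))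
    (E : (Fin n → Bool) → Set (Fin n → Bool)) : ℝ :=
  (∫⁻ ω, κ (fun i => (ω i).2) (E fun i => (ω i).1) ∂(M.jointN n)).toReal

end Model

/-- `sortedVal n w i` is the `i`-th order statistic `w_(i)` (for `1 ≤ i ≤ n`) of
`w 0, …, w (n-1)`. -/
noncomputable def sortedVal (n : ℕ) (w : Fin n → ℝ) (i : ℕ) : ℝ :=
  ((Multiset.map w Finset.univ.val).sort (· ≤ ·)).getD (i - 1) 0

/-- `avgLow n w k = (1/k) Σ_{i=1}^k w_(i)` (equal to `0` when `k = 0`). -/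
noncomputable def avgLow (n : ℕ) (w : Fin n → ℝ) (k : ℕ) : ℝ :=
  (∑ i ∈ Finset.Icc 1 k, sortedVal n w i) / k

/-- `avgHigh n w k = (1/(n-k)) Σ_{i=k+1}^n (1 - w_(i))` (equal to `0` when `k = n`). -/
noncomputable def avgHigh (n : ℕ) (w : Fin n → ℝ) (k : ℕ) : ℝ :=
  (∑ i ∈ Finset.Icc (k + 1) n, (1 - sortedVal n w i)) / ((n : ℝ) - k)

/-- The greatest convex minorant on `[0,1]` of a function `h`, evaluated at `α`. -/
noncomputable def gcm (h : ℝ → ℝ) (α : ℝ) : ℝ :=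
  sSup {y | ∃ C : ℝ → ℝ, ConvexOn ℝ (Set.Icc 0 1) C ∧
    (∀ t ∈ Set.Icc (0 : ℝ) 1, C t ≤ h t) ∧ y = C α}

end TwoGroup

namespace TwoGroup

namespace Model

variable {𝒳 : Type*} [MeasurableSpace 𝒳] (M : Model 𝒳)

/-- The oracle rule `δ^n_OR(α)`: with probability `(α2-α)/(α2-α1)` use `δ^n_NP(α1)` and with
probability `(α-α1)/(α2-α1)` use `δ^n_NP(α2)`; if `α1 = α2` it is just `δ^n_NP(α)`. -/
noncomputable def oracle (α α1 α2 : ℝ) (n : ℕ) : (Fin n → 𝒳) → Measure (Fin n → Bool) :=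
  if α1 = α2 then M.NP α n
  else fun x =>
    (ENNReal.ofReal ((α2 - α) / (α2 - α1))) • M.NP α1 n x +
      (ENNReal.ofReal ((α - α1) / (α2 - α1))) • M.NP α2 n x

end Model

section GreatestConvexMinorant

/-- A value which is a convex combination of values of `h`, and which is approximated from below
by affine minorants of `h`, is the value of the greatest convex minorant. -/
theorem gcm_eq_of_forall_affine_le {h : ℝ → ℝ} {α s t l : ℝ}
    (hs : s ∈ Set.Icc (0 : ℝ) 1) (ht : t ∈ Set.Icc (0 : ℝ) 1) (hl : l ∈ Set.Icc (0 : ℝ) 1)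
    (hα : l * s + (1 - l) * t = α)
    (H : ∀ ε > 0, ∃ k : ℝ, ∀ r ∈ Set.Icc (0 : ℝ) 1,
      l * h s + (1 - l) * h t - ε + k * (r - α) ≤ h r) :
    gcm h α = l * h s + (1 - l) * h t := by
  have upper : ∀ y ∈ {y | ∃ C : ℝ → ℝ, ConvexOn ℝ (Set.Icc 0 1) C ∧
      (∀ t ∈ Set.Icc (0 : ℝ) 1, C t ≤ h t) ∧ y = C α}, y ≤ l * h s + (1 - l) * h t := by
    rintro y ⟨C, hC, hle, rfl⟩
    have h1 := hC.2 hs ht hl.1 (sub_nonneg.2 hl.2) (by ring)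
    simp only [smul_eq_mul, hα] at h1
    have h2 := mul_le_mul_of_nonneg_left (hle s hs) hl.1
    have h3 := mul_le_mul_of_nonneg_left (hle t ht) (sub_nonneg.2 hl.2)
    linarith
  have lower : ∀ ε > 0, l * h s + (1 - l) * h t - ε ∈ {y | ∃ C : ℝ → ℝ,
      ConvexOn ℝ (Set.Icc 0 1) C ∧ (∀ t ∈ Set.Icc (0 : ℝ) 1, C t ≤ h t) ∧ y = C α} := by
    intro ε hε
    obtain ⟨k, hk⟩ := H ε hε
    refine ⟨fun r => l * h s + (1 - l) * h t - ε + k * (r - α), ⟨convex_Icc _ _, ?_⟩, hk, ?_⟩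
    · intro x _ y _ a b _ _ hab
      obtain rfl : b = 1 - a := by linarith
      simp only [smul_eq_mul]
      exact le_of_eq (by ring)
    · simp
  refine le_antisymm (csSup_le ⟨_, lower 1 one_pos⟩ upper) ?_
  exact le_of_forall_pos_sub_le fun ε hε => le_csSup ⟨_, upper⟩ (lower ε hε)

theorem lowerSemicontinuousOn_mul_comp {E : Type*} [TopologicalSpace E] {h : ℝ → ℝ}
    {I : Set ℝ} (hh : LowerSemicontinuousOn h I) {K : Set E} {c g : E → ℝ}
    (hc : Continuous c) (hg : Continuous g) (hc0 : ∀ x ∈ K, 0 ≤ c x) (hgI : Set.MapsTo g K I) :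
    LowerSemicontinuousOn (fun x => c x * h (g x)) K := by
  intro x hx y hy
  have hcont : Tendsto (fun z => c x * z) (nhdsWithin (h (g x)) (Set.Iio (h (g x))))
      (nhds (c x * h (g x))) :=
    (continuous_const.mul continuous_id).continuousWithinAt.tendsto
  obtain ⟨z, hz, hzlt⟩ :=
    ((hcont.eventually (lt_mem_nhds hy)).and self_mem_nhdsWithin).exists
  have e1 : ∀ᶠ w in nhdsWithin x K, z < h (g w) :=
    (hg.continuousWithinAt.tendsto_nhdsWithin hgI).eventually (hh (g x) (hgI hx) z hzlt)
  have e2 : ∀ᶠ w in nhdsWithin x K, y < c w * z :=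
    ((hc.mul continuous_const).continuousWithinAt).eventually (lt_mem_nhds hz)
  filter_upwards [e1, e2, self_mem_nhdsWithin] with w h1 h2 hw
  exact h2.trans_le (mul_le_mul_of_nonneg_left h1.le (hc0 w hw))

theorem exists_isMin_two_point {h : ℝ → ℝ} (hh : LowerSemicontinuousOn h (Set.Icc 0 1))
    {α : ℝ} (hα : α ∈ Set.Icc (0 : ℝ) 1) :
    ∃ s ∈ Set.Icc 0 α, ∃ t ∈ Set.Icc α 1, ∃ l ∈ Set.Icc (0 : ℝ) 1, l * s + (1 - l) * t = α ∧
      ∀ s' ∈ Set.Icc 0 α, ∀ t' ∈ Set.Icc α 1, ∀ l' ∈ Set.Icc (0 : ℝ) 1,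
        l' * s' + (1 - l') * t' = α →
          l * h s + (1 - l) * h t ≤ l' * h s' + (1 - l') * h t' := by
  set K : Set (ℝ × ℝ × ℝ) := (Set.Icc 0 α ×ˢ Set.Icc α 1 ×ˢ Set.Icc 0 1) ∩
    {p | p.2.2 * p.1 + (1 - p.2.2) * p.2.1 = α} with hK
  have hKc : IsCompact K := by
    refine (isCompact_Icc.prod (isCompact_Icc.prod isCompact_Icc)).inter_right ?_
    exact isClosed_eq (by fun_prop) continuous_const
  have hne : K.Nonempty := by
    refine ⟨(α, α, 1), ⟨⟨⟨hα.1, le_rfl⟩, ⟨le_rfl, hα.2⟩, zero_le_one, le_rfl⟩, ?_⟩⟩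
    simp
  have hlsc : LowerSemicontinuousOn
      (fun p : ℝ × ℝ × ℝ => p.2.2 * h p.1 + (1 - p.2.2) * h p.2.1) K := by
    refine LowerSemicontinuousOn.add ?_ ?_
    · refine lowerSemicontinuousOn_mul_comp hh (c := fun p : ℝ × ℝ × ℝ => p.2.2)
        (g := fun p => p.1)
        (by fun_prop) (by fun_prop) (fun p hp => hp.1.2.2.1) ?_
      exact fun p hp => ⟨hp.1.1.1, hp.1.1.2.trans hα.2⟩
    · refine lowerSemicontinuousOn_mul_comp hh (c := fun p : ℝ × ℝ × ℝ => 1 - p.2.2)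
        (g := fun p => p.2.1)
        (by fun_prop) (by fun_prop) (fun p hp => sub_nonneg.2 hp.1.2.2.2) ?_
      exact fun p hp => ⟨hα.1.trans hp.1.2.1.1, hp.1.2.1.2⟩
  obtain ⟨⟨s, t, l⟩, ⟨⟨hs, ht, hl⟩, heq⟩, hmin⟩ := hlsc.exists_isMinOn hne hKc
  refine ⟨s, hs, t, ht, l, hl, heq, fun s' hs' t' ht' l' hl' he => ?_⟩
  exact hmin (show (s', t', l') ∈ K from ⟨⟨hs', ht', hl'⟩, he⟩)

/-- The greatest convex minorant of a nonnegative lower semicontinuous function vanishing at `1`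
is attained by a convex combination of two values. -/
theorem exists_gcm_eq_two_point {h : ℝ → ℝ} (hh : LowerSemicontinuousOn h (Set.Icc 0 1))
    (h0 : ∀ t ∈ Set.Icc (0 : ℝ) 1, 0 ≤ h t) (h1 : h 1 = 0)
    {α : ℝ} (hα : α ∈ Set.Icc (0 : ℝ) 1) :
    ∃ s ∈ Set.Icc 0 α, ∃ t ∈ Set.Icc α 1, ∃ l ∈ Set.Icc (0 : ℝ) 1, l * s + (1 - l) * t = α ∧
      gcm h α = l * h s + (1 - l) * h t := by
  rcases eq_or_lt_of_le hα.1 with rfl | hα0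
  · refine ⟨0, by simp, 0, by simp, 1, by simp, by simp, ?_⟩
    refine gcm_eq_of_forall_affine_le (by simp) (by simp) (by simp) (by simp) fun ε hε => ?_
    have e := hh 0 (by simp) (h 0 - ε) (by linarith)
    obtain ⟨δ, hδ, hd⟩ := Metric.eventually_nhds_iff.1 (eventually_nhdsWithin_iff.1 e)
    have hh0 := h0 0 (by simp)
    refine ⟨-(h 0 / δ), fun r hr => ?_⟩
    by_cases hrd : r < δ
    · have := hd (y := r) (by simpa [abs_of_nonneg hr.1] using hrd) hr
      have : 0 ≤ h 0 / δ * r := mul_nonneg (div_nonneg hh0 hδ.le) hr.1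
      linarith
    · have : h 0 ≤ h 0 / δ * r := by
        rw [div_mul_eq_mul_div, le_div_iff₀ hδ]
        exact mul_le_mul_of_nonneg_left (not_lt.1 hrd) hh0
      have := h0 r hr
      linarith
  rcases eq_or_lt_of_le hα.2 with rfl | hα1
  · refine ⟨1, by simp, 1, by simp, 1, by simp, by simp, ?_⟩
    refine gcm_eq_of_forall_affine_le (by simp) (by simp) (by simp) (by simp) fun ε hε => ?_
    refine ⟨0, fun r hr => ?_⟩
    have := h0 r hr
    rw [h1]
    linarith
  obtain ⟨s, hs, t, ht, l, hl, heq, hmin⟩ := exists_isMin_two_point hh hα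
  refine ⟨s, hs, t, ht, l, hl, heq, gcm_eq_of_forall_affine_le ⟨hs.1, hs.2.trans hα.2⟩
    ⟨hα.1.trans ht.1, ht.2⟩ hl heq fun ε hε => ?_⟩
  set m := l * h s + (1 - l) * h t
  have hmα : m ≤ h α := by
    have := hmin α ⟨hα.1, le_rfl⟩ α ⟨le_rfl, hα.2⟩ 1 (by simp) (by simp)
    simpa using this
  have key : ∀ p, 0 ≤ p → p < α → ∀ q, α < q → q ≤ 1 →
      (m - h p) / (α - p) ≤ (h q - m) / (q - α) := by
    intro p hp hpα q hqα hq
    have hpq : 0 < q - p := by linarith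
    have := hmin p ⟨hp, hpα.le⟩ q ⟨hqα.le, hq⟩ ((q - α) / (q - p))
      ⟨div_nonneg (by linarith) hpq.le, (div_le_one hpq).2 (by linarith)⟩ (by field_simp; ring)
    have e : (q - α) / (q - p) * h p + (1 - (q - α) / (q - p)) * h q =
        ((q - α) * h p + (α - p) * h q) / (q - p) := by field_simp; ring
    rw [e, le_div_iff₀ hpq] at this
    rw [div_le_div_iff₀ (by linarith) (by linarith)]
    linarith
  set k := sSup ((fun p => (m - h p) / (α - p)) '' Set.Ico 0 α)
  have hlow : ∀ p, 0 ≤ p → p < α → (m - h p) / (α - p) ≤ k := fun p hp hpα =>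
    le_csSup ⟨(h 1 - m) / (1 - α), by
      rintro _ ⟨p', hp', rfl⟩
      exact key p' hp'.1 hp'.2 1 hα1 le_rfl⟩ ⟨p, ⟨hp, hpα⟩, rfl⟩
  have hup : ∀ q, α < q → q ≤ 1 → k ≤ (h q - m) / (q - α) := fun q hqα hq =>
    csSup_le ⟨_, 0, ⟨le_rfl, hα0⟩, rfl⟩ (by
      rintro _ ⟨p', hp', rfl⟩
      exact key p' hp'.1 hp'.2 q hqα hq)
  refine ⟨k, fun r hr => ?_⟩
  rcases lt_trichotomy r α with hlt | rfl | hgt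
  · have := hlow r hr.1 hlt
    rw [div_le_iff₀ (by linarith)] at this
    linarith
  · linarith
  · have := hup r hgt hr.2
    rw [le_div_iff₀ (by linarith)] at this
    linarith

end GreatestConvexMinorant

namespace Model

variable {𝒳 : Type*} [MeasurableSpace 𝒳] (M : Model 𝒳)

theorem π0_nonneg : 0 ≤ M.π0 := M.π0_mem.1.le

theorem π1_nonneg : 0 ≤ M.π1 := sub_nonneg.2 M.π0_mem.2.le

theorem measurable_f : Measurable M.f :=
  (M.f0_meas.const_mul _).add (M.f1_meas.const_mul _)

theorem f_nonneg (x : 𝒳) : 0 ≤ M.f x :=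
  add_nonneg (mul_nonneg M.π0_nonneg (M.f0_nonneg x)) (mul_nonneg M.π1_nonneg (M.f1_nonneg x))

theorem measurable_Lfdr : Measurable M.Lfdr := (M.f0_meas.const_mul _).div M.measurable_f

theorem Lfdr_nonneg (x : 𝒳) : 0 ≤ M.Lfdr x :=
  div_nonneg (mul_nonneg M.π0_nonneg (M.f0_nonneg x)) (M.f_nonneg x)

theorem Lfdr_le_one (x : 𝒳) : M.Lfdr x ≤ 1 :=
  div_le_one_of_le₀ (le_add_of_nonneg_right (mul_nonneg M.π1_nonneg (M.f1_nonneg x)))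
    (M.f_nonneg x)

theorem f_mul_Lfdr (x : 𝒳) : M.f x * M.Lfdr x = M.π0 * M.f0 x := by
  by_cases h : M.f x = 0
  · have h0 : 0 ≤ M.π0 * M.f0 x := mul_nonneg M.π0_nonneg (M.f0_nonneg x)
    have h1 : 0 ≤ M.π1 * M.f1 x := mul_nonneg M.π1_nonneg (M.f1_nonneg x)
    have h2 : M.π0 * M.f0 x + M.π1 * M.f1 x = 0 := h
    rw [h, zero_mul]
    linarith
  · exact mul_div_cancel₀ _ h

theorem f_mul_one_sub_Lfdr (x : 𝒳) : M.f x * (1 - M.Lfdr x) = M.π1 * M.f1 x := by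
  have : M.f x = M.π0 * M.f0 x + M.π1 * M.f1 x := rfl
  rw [mul_sub, f_mul_Lfdr, mul_one, this, add_sub_cancel_left]

theorem ofReal_π0_add_ofReal_π1 : ENNReal.ofReal M.π0 + ENNReal.ofReal M.π1 = 1 := by
  rw [← ENNReal.ofReal_add M.π0_nonneg M.π1_nonneg, π1]
  simp

instance : IsProbabilityMeasure M.joint := by
  have := M.f0_prob
  have := M.f1_prob
  refine ⟨?_⟩
  simp [joint, M.ofReal_π0_add_ofReal_π1]

instance (n : ℕ) : IsProbabilityMeasure (M.jointN n) := by
  unfold jointN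
  infer_instance

theorem Pmix_eq : M.Pmix =
    ENNReal.ofReal M.π0 • M.base.withDensity (fun x => ENNReal.ofReal (M.f0 x)) +
      ENNReal.ofReal M.π1 • M.base.withDensity (fun x => ENNReal.ofReal (M.f1 x)) := by
  have m0 : Measurable fun x => ENNReal.ofReal (M.f0 x) := M.f0_meas.ennreal_ofReal
  have m1 : Measurable fun x => ENNReal.ofReal (M.f1 x) := M.f1_meas.ennreal_ofReal
  rw [← withDensity_smul _ m0, ← withDensity_smul _ m1, ← withDensity_add_left (m0.const_smul _)]
  unfold Pmix
  congr 1
  ext x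
  simp only [f, Pi.add_apply, Pi.smul_apply, smul_eq_mul]
  rw [ENNReal.ofReal_add (mul_nonneg M.π0_nonneg (M.f0_nonneg x))
    (mul_nonneg M.π1_nonneg (M.f1_nonneg x)), ENNReal.ofReal_mul M.π0_nonneg,
    ENNReal.ofReal_mul M.π1_nonneg]

instance : IsProbabilityMeasure M.Pmix := by
  have := M.f0_prob
  have := M.f1_prob
  refine ⟨?_⟩
  rw [Pmix_eq]
  simp only [Measure.coe_add, Measure.coe_smul, Pi.add_apply, Pi.smul_apply, measure_univ,
    smul_eq_mul, mul_one, M.ofReal_π0_add_ofReal_π1]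

instance : IsProbabilityMeasure M.νW :=
  Measure.isProbabilityMeasure_map M.measurable_Lfdr.aemeasurable

theorem integral_withDensity_ofReal {μ : Measure 𝒳} {p : 𝒳 → ℝ} (hp : Measurable p)
    (hp0 : ∀ x, 0 ≤ p x) (g : 𝒳 → ℝ) :
    ∫ x, g x ∂μ.withDensity (fun x => ENNReal.ofReal (p x)) = ∫ x, p x * g x ∂μ := by
  rw [integral_withDensity_eq_integral_toReal_smul hp.ennreal_ofReal (by simp)]
  simp [ENNReal.toReal_ofReal (hp0 _)]

theorem integrable_of_isProbabilityMeasure_withDensity {μ : Measure 𝒳} {p : 𝒳 → ℝ}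
    (hp : Measurable p) (hp0 : ∀ x, 0 ≤ p x)
    (h : IsProbabilityMeasure (μ.withDensity fun x => ENNReal.ofReal (p x))) :
    Integrable p μ := by
  refine ⟨hp.aestronglyMeasurable, ?_⟩
  rw [hasFiniteIntegral_iff_ofReal (ae_of_all _ hp0), ← setLIntegral_univ,
    ← withDensity_apply _ MeasurableSet.univ, measure_univ]
  exact ENNReal.one_lt_top

theorem integral_joint {F : Bool × 𝒳 → ℝ} (hF : Measurable F) {C : ℝ} (hC : ∀ z, ‖F z‖ ≤ C) :
    ∫ z, F z ∂M.joint =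
      ∫ x, (M.Lfdr x * F (false, x) + (1 - M.Lfdr x) * F (true, x)) ∂M.Pmix := by
  have := M.f0_prob
  have := M.f1_prob
  have hFb : ∀ b, Measurable fun x => F (b, x) := fun b => hF.comp measurable_prodMk_left
  have hInt : ∀ μ : Measure (Bool × 𝒳), IsFiniteMeasure μ → Integrable F μ := fun μ _ =>
    Integrable.of_bound hF.aestronglyMeasurable C (ae_of_all _ hC)
  have i0 : Integrable (fun x => M.f0 x * F (false, x)) M.base :=
    (integrable_of_isProbabilityMeasure_withDensity M.f0_meas M.f0_nonneg M.f0_prob).mul_bdd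
      (hFb _).aestronglyMeasurable (ae_of_all _ fun x => hC _)
  have i1 : Integrable (fun x => M.f1 x * F (true, x)) M.base :=
    (integrable_of_isProbabilityMeasure_withDensity M.f1_meas M.f1_nonneg M.f1_prob).mul_bdd
      (hFb _).aestronglyMeasurable (ae_of_all _ fun x => hC _)
  have hd : ∀ (b : Bool) (μ : Measure 𝒳), SFinite μ →
      ∫ z, F z ∂((Measure.dirac b).prod μ) = ∫ x, F (b, x) ∂μ := by
    intro b μ _
    rw [Measure.dirac_prod, integral_map measurable_prodMk_left.aemeasurable
      hF.aestronglyMeasurable]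
  unfold joint Pmix
  rw [integral_add_measure, integral_smul_measure, integral_smul_measure, hd _ _ inferInstance,
    hd _ _ inferInstance, integral_withDensity_ofReal M.f0_meas M.f0_nonneg,
    integral_withDensity_ofReal M.f1_meas M.f1_nonneg,
    integral_withDensity_ofReal M.measurable_f M.f_nonneg,
    ENNReal.toReal_ofReal M.π0_nonneg, ENNReal.toReal_ofReal M.π1_nonneg, smul_eq_mul,
    smul_eq_mul, ← integral_const_mul, ← integral_const_mul,
    ← integral_add (i0.const_mul _) (i1.const_mul _)]
  · refine integral_congr_ae (ae_of_all _ fun x => ?_)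
    simp only
    rw [mul_add, ← mul_assoc (M.f x), ← mul_assoc (M.f x), f_mul_Lfdr, f_mul_one_sub_Lfdr]
    ring
  · exact (hInt _ inferInstance).smul_measure ENNReal.ofReal_ne_top
  · exact (hInt _ inferInstance).smul_measure ENNReal.ofReal_ne_top

theorem νW_Iic_of_neg {t : ℝ} (ht : t < 0) : M.νW (Set.Iic t) = 0 := by
  rw [νW, Measure.map_apply M.measurable_Lfdr measurableSet_Iic]
  have : M.Lfdr ⁻¹' Set.Iic t = ∅ := by
    ext x
    simpa using ht.trans_le (M.Lfdr_nonneg x)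
  rw [this, measure_empty]

theorem νW_Iio_zero : M.νW (Set.Iio 0) = 0 := by
  rw [νW, Measure.map_apply M.measurable_Lfdr measurableSet_Iio]
  have : M.Lfdr ⁻¹' Set.Iio 0 = ∅ := by
    ext x
    simpa using M.Lfdr_nonneg x
  rw [this, measure_empty]

theorem G_eq_cdf : M.G = cdf M.νW := by
  ext t
  rw [cdf_eq_real]
  rfl

theorem G_of_neg {t : ℝ} (ht : t < 0) : M.G t = 0 := by
  simp [G, M.νW_Iic_of_neg ht]

theorem G_one : M.G 1 = 1 := by
  rw [G, νW, Measure.map_apply M.measurable_Lfdr measurableSet_Iic]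
  have : M.Lfdr ⁻¹' Set.Iic 1 = Set.univ := by
    ext x
    simpa using M.Lfdr_le_one x
  simp [this]

theorem G_eq_add (t : ℝ) : M.G t = M.Gbar t + M.atom t := by
  rw [G, Gbar, atom, ← Set.Iio_union_right, measure_union (by simp) (measurableSet_singleton t),
    ENNReal.toReal_add (measure_ne_top _ _) (measure_ne_top _ _)]

theorem Ginv_zero : M.Ginv 0 = 0 := by
  have : {t | (0 : ℝ) ≤ M.G t} = Set.univ := Set.eq_univ_of_forall fun t => ENNReal.toReal_nonneg
  rw [Ginv, this, Real.sInf_univ]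

theorem Gbar_zero : M.Gbar 0 = 0 := by
  simp [Gbar, M.νW_Iio_zero]

theorem bddBelow_le_G {u : ℝ} (hu : 0 < u) : BddBelow {t | u ≤ M.G t} :=
  ⟨0, fun t ht => by
    by_contra h
    have : u ≤ M.G t := ht
    rw [M.G_of_neg (not_le.1 h)] at this
    linarith⟩

theorem le_G_Ginv {u : ℝ} (hu : u ∈ Set.Icc (0 : ℝ) 1) : u ≤ M.G (M.Ginv u) := by
  rcases eq_or_lt_of_le hu.1 with rfl | h0
  · exact ENNReal.toReal_nonneg
  have hne : {t | u ≤ M.G t}.Nonempty := ⟨1, by simpa [M.G_one] using hu.2⟩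
  have hcont : Tendsto M.G (nhdsWithin (M.Ginv u) (Set.Ioi (M.Ginv u)))
      (nhds (M.G (M.Ginv u))) := by
    rw [G_eq_cdf]
    exact ((cdf M.νW).right_continuous _).tendsto.mono_left
      (nhdsWithin_mono _ Set.Ioi_subset_Ici_self)
  refine ge_of_tendsto hcont (eventually_nhdsWithin_of_forall fun t ht => ?_)
  obtain ⟨s, hs, hst⟩ := exists_lt_of_csInf_lt hne ht
  have hs' : u ≤ M.G s := hs
  rw [G_eq_cdf] at hs' ⊢
  exact hs'.trans (monotone_cdf _ hst.le)

theorem Gbar_Ginv_le {u : ℝ} (hu : u ∈ Set.Icc (0 : ℝ) 1) : M.Gbar (M.Ginv u) ≤ u := by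
  rcases eq_or_lt_of_le hu.1 with rfl | h0
  · rw [Ginv_zero, Gbar_zero]
  have hlt : ∀ s, s < M.Ginv u → M.G s < u := fun s hs =>
    not_le.1 fun h => (notMem_of_lt_csInf hs (M.bddBelow_le_G h0)) h
  have e : M.Gbar (M.Ginv u) = Function.leftLim (cdf M.νW) (M.Ginv u) := by
    have hl := (cdf M.νW).measure_Iio (tendsto_cdf_atBot _) (M.Ginv u)
    rw [measure_cdf, sub_zero] at hl
    rw [Gbar, hl, ENNReal.toReal_ofReal]
    refine ge_of_tendsto ((monotone_cdf M.νW).tendsto_leftLim _) (Eventually.of_forall fun t => ?_)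
    exact cdf_nonneg _ _
  rw [e]
  refine le_of_tendsto ((monotone_cdf M.νW).tendsto_leftLim _)
    (eventually_nhdsWithin_of_forall fun t ht => ?_)
  rw [← M.G_eq_cdf]
  exact (hlt t ht).le

theorem atom_nonneg (t : ℝ) : 0 ≤ M.atom t := ENNReal.toReal_nonneg

theorem pu_mem {u : ℝ} (hu : u ∈ Set.Icc (0 : ℝ) 1) : M.pu u ∈ Set.Icc (0 : ℝ) 1 := by
  have h1 := M.le_G_Ginv hu
  have h2 := M.Gbar_Ginv_le hu
  rw [G_eq_add] at h1
  exact ⟨div_nonneg (by linarith) (M.atom_nonneg _),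
    div_le_one_of_le₀ (by linarith) (M.atom_nonneg _)⟩

theorem Gbar_add_pu_mul_atom {u : ℝ} (hu : u ∈ Set.Icc (0 : ℝ) 1) :
    M.Gbar (M.Ginv u) + M.pu u * M.atom (M.Ginv u) = u := by
  have h1 := M.le_G_Ginv hu
  have h2 := M.Gbar_Ginv_le hu
  rw [G_eq_add] at h1
  by_cases h : M.atom (M.Ginv u) = 0
  · rw [h] at h1 ⊢
    linarith
  · rw [pu, div_mul_cancel₀ _ h]
    ring

/-- The probability of rejecting at the observation `x` under the rule which thresholds the local
false discovery rate so as to reject with overall probability `u`. -/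
noncomputable def threshold (u : ℝ) (x : 𝒳) : ℝ :=
  if M.Lfdr x < M.Ginv u then 1
  else if M.Lfdr x = M.Ginv u then M.pu u
  else 0

theorem measurable_threshold (u : ℝ) : Measurable (M.threshold u) :=
  Measurable.ite (measurableSet_lt M.measurable_Lfdr measurable_const) measurable_const
    (Measurable.ite (measurableSet_eq_fun M.measurable_Lfdr measurable_const) measurable_const
      measurable_const)

theorem threshold_mem {u : ℝ} (hu : u ∈ Set.Icc (0 : ℝ) 1) (x : 𝒳) :
    M.threshold u x ∈ Set.Icc (0 : ℝ) 1 := by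
  unfold threshold
  split_ifs
  · simp
  · exact M.pu_mem hu
  · simp

theorem integrable_of_mem_Icc {μ : Measure 𝒳} [IsFiniteMeasure μ] {g : 𝒳 → ℝ}
    (hg : Measurable g) (h : ∀ x, g x ∈ Set.Icc (0 : ℝ) 1) : Integrable g μ :=
  Integrable.of_bound hg.aestronglyMeasurable 1
    (ae_of_all _ fun x => by rw [Real.norm_of_nonneg (h x).1]; exact (h x).2)

theorem integrable_Lfdr_mul {g : 𝒳 → ℝ} (hg : Measurable g) (h : ∀ x, g x ∈ Set.Icc (0 : ℝ) 1) :
    Integrable (fun x => M.Lfdr x * g x) M.Pmix :=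
  integrable_of_mem_Icc (M.measurable_Lfdr.mul hg) fun x =>
    ⟨mul_nonneg (M.Lfdr_nonneg x) (h x).1, mul_le_one₀ (M.Lfdr_le_one x) (h x).1 (h x).2⟩

theorem integral_comp_Lfdr_mul_threshold {k : ℝ → ℝ} (hk : Measurable k)
    (hi : Integrable k M.νW) (u : ℝ) :
    ∫ x, k (M.Lfdr x) * M.threshold u x ∂M.Pmix =
      (∫ w in Set.Iio (M.Ginv u), k w ∂M.νW) +
        M.pu u * (k (M.Ginv u) * M.atom (M.Ginv u)) := by
  unfold threshold
  generalize M.Ginv u = t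
  have e : ∀ x, k (M.Lfdr x) *
      (if M.Lfdr x < t then 1 else if M.Lfdr x = t then M.pu u else 0) =
      (fun w => (Set.Iio t).indicator k w + M.pu u * ({t} : Set ℝ).indicator k w) (M.Lfdr x) := by
    intro x
    simp only [Set.indicator_apply, Set.mem_Iio, Set.mem_singleton_iff]
    rcases lt_trichotomy (M.Lfdr x) t with h | h | h
    · simp [h, h.ne]
    · simp [h, mul_comm]
    · simp [h.not_gt, h.ne']
  simp_rw [e]
  rw [← integral_map (φ := M.Lfdr) (f := fun w => (Set.Iio t).indicator k w +
    M.pu u * ({t} : Set ℝ).indicator k w) M.measurable_Lfdr.aemeasurable]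
  · change ∫ w, _ ∂M.νW = _
    rw [integral_add (hi.indicator measurableSet_Iio)
      ((hi.indicator (measurableSet_singleton t)).const_mul _), integral_const_mul,
      integral_indicator measurableSet_Iio, integral_indicator (measurableSet_singleton t),
      integral_singleton]
    simp [atom, Measure.real, mul_comm]
  · exact ((hk.indicator measurableSet_Iio).add
      ((hk.indicator (measurableSet_singleton t)).const_mul _)).aestronglyMeasurable

theorem integral_threshold {u : ℝ} (hu : u ∈ Set.Icc (0 : ℝ) 1) :
    ∫ x, M.threshold u x ∂M.Pmix = u := by
  have := M.integral_comp_Lfdr_mul_threshold (k := fun _ => 1) measurable_const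
    (integrable_const _) u
  simp only [one_mul, integral_const, smul_eq_mul, mul_one, measureReal_restrict_apply_univ]
    at this
  rw [this]
  exact M.Gbar_add_pu_mul_atom hu

theorem integrable_id_νW : Integrable (fun w : ℝ => w) M.νW := by
  refine (integrable_map_measure (f := M.Lfdr) aestronglyMeasurable_id
    M.measurable_Lfdr.aemeasurable).2 ?_
  exact integrable_of_mem_Icc M.measurable_Lfdr fun x => ⟨M.Lfdr_nonneg x, M.Lfdr_le_one x⟩

/-- The probability of a false rejection under the threshold rule rejecting with probability
`u`. -/
noncomputable def falseRej (u : ℝ) : ℝ := ∫ x, M.Lfdr x * M.threshold u x ∂M.Pmix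

/-- The proportion of nulls, as the mean of the local false discovery rate. -/
noncomputable def meanLfdr : ℝ := ∫ x, M.Lfdr x ∂M.Pmix

theorem integrable_Lfdr : Integrable M.Lfdr M.Pmix :=
  integrable_of_mem_Icc M.measurable_Lfdr fun x => ⟨M.Lfdr_nonneg x, M.Lfdr_le_one x⟩

theorem integral_accept {g : 𝒳 → ℝ} (hg : Measurable g) (h : ∀ x, g x ∈ Set.Icc (0 : ℝ) 1) :
    ∫ x, (1 - M.Lfdr x) * (1 - g x) ∂M.Pmix =
      1 - M.meanLfdr - ∫ x, g x ∂M.Pmix + ∫ x, M.Lfdr x * g x ∂M.Pmix := by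
  have hgi : Integrable g M.Pmix := integrable_of_mem_Icc hg h
  have e : ∀ x, (1 - M.Lfdr x) * (1 - g x) = 1 - M.Lfdr x - g x + M.Lfdr x * g x :=
    fun x => by ring
  simp_rw [e]
  rw [integral_add _ (M.integrable_Lfdr_mul hg h), integral_sub _ hgi,
    integral_sub (integrable_const _) M.integrable_Lfdr]
  · simp [meanLfdr]
  · exact (integrable_const _).sub M.integrable_Lfdr
  · exact ((integrable_const _).sub M.integrable_Lfdr).sub hgi

/-- The probability of a false acceptance under the threshold rule rejecting with probability
`u`. -/
noncomputable def falseAcc (u : ℝ) : ℝ := 1 - M.meanLfdr - u + M.falseRej u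

theorem integral_accept_threshold {u : ℝ} (hu : u ∈ Set.Icc (0 : ℝ) 1) :
    ∫ x, (1 - M.Lfdr x) * (1 - M.threshold u x) ∂M.Pmix = M.falseAcc u := by
  rw [M.integral_accept (M.measurable_threshold u) (M.threshold_mem hu), M.integral_threshold hu]
  rfl

/-- Thresholding the local false discovery rate minimizes the probability of a false rejection
among the tests with the same probability of rejecting. -/
theorem falseRej_le {u : ℝ} (hu : u ∈ Set.Icc (0 : ℝ) 1) {g : 𝒳 → ℝ} (hg : Measurable g)
    (h : ∀ x, g x ∈ Set.Icc (0 : ℝ) 1) (hgu : ∫ x, g x ∂M.Pmix = u) :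
    M.falseRej u ≤ ∫ x, M.Lfdr x * g x ∂M.Pmix := by
  have hgi : Integrable g M.Pmix := integrable_of_mem_Icc hg h
  have hti : Integrable (M.threshold u) M.Pmix :=
    integrable_of_mem_Icc (M.measurable_threshold u) (M.threshold_mem hu)
  have hle : ∫ x, (M.Lfdr x * M.threshold u x - M.Ginv u * M.threshold u x) ∂M.Pmix ≤
      ∫ x, (M.Lfdr x * g x - M.Ginv u * g x) ∂M.Pmix := by
    refine integral_mono
      ((M.integrable_Lfdr_mul (M.measurable_threshold u) (M.threshold_mem hu)).sub
        (hti.const_mul _))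
      ((M.integrable_Lfdr_mul hg h).sub (hgi.const_mul _)) fun x => ?_
    simp only
    rw [← sub_mul, ← sub_mul]
    unfold threshold
    have := h x
    split_ifs with h1 h2
    · nlinarith [this.1, this.2]
    · simp [h2]
    · have : 0 ≤ (M.Lfdr x - M.Ginv u) * g x :=
        mul_nonneg (sub_nonneg.2 (not_lt.1 h1)) this.1
      simpa using this
  rw [integral_sub (M.integrable_Lfdr_mul (M.measurable_threshold u) (M.threshold_mem hu))
    (hti.const_mul _), integral_sub (M.integrable_Lfdr_mul hg h) (hgi.const_mul _),
    integral_const_mul, integral_const_mul, M.integral_threshold hu, hgu] at hle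
  unfold falseRej
  linarith

theorem falseRej_nonneg {u : ℝ} (hu : u ∈ Set.Icc (0 : ℝ) 1) : 0 ≤ M.falseRej u :=
  integral_nonneg fun x => mul_nonneg (M.Lfdr_nonneg x) (M.threshold_mem hu x).1

theorem falseRej_le_self {u : ℝ} (hu : u ∈ Set.Icc (0 : ℝ) 1) : M.falseRej u ≤ u := by
  conv_rhs => rw [← M.integral_threshold hu]
  refine integral_mono (M.integrable_Lfdr_mul (M.measurable_threshold u) (M.threshold_mem hu))
    (integrable_of_mem_Icc (M.measurable_threshold u) (M.threshold_mem hu)) fun x => ?_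
  exact mul_le_of_le_one_left (M.threshold_mem hu x).1 (M.Lfdr_le_one x)

theorem falseAcc_nonneg {u : ℝ} (hu : u ∈ Set.Icc (0 : ℝ) 1) : 0 ≤ M.falseAcc u := by
  rw [← M.integral_accept_threshold hu]
  exact integral_nonneg fun x => mul_nonneg (sub_nonneg.2 (M.Lfdr_le_one x))
    (sub_nonneg.2 (M.threshold_mem hu x).2)

theorem falseAcc_le {u : ℝ} (hu : u ∈ Set.Icc (0 : ℝ) 1) : M.falseAcc u ≤ 1 - u := by
  have h := M.falseRej_le hu (g := fun _ => u) measurable_const (fun _ => hu) (by simp)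
  rw [integral_mul_const] at h
  change M.falseRej u ≤ M.meanLfdr * u at h
  have hm : M.meanLfdr ∈ Set.Icc (0 : ℝ) 1 := by
    refine ⟨integral_nonneg M.Lfdr_nonneg, ?_⟩
    have := integral_mono M.integrable_Lfdr (integrable_const 1) M.Lfdr_le_one
    simpa [meanLfdr] using this
  unfold falseAcc
  nlinarith [hm.1, hm.2, hu.1, hu.2]

theorem mul_a {u : ℝ} (hu : u ∈ Set.Icc (0 : ℝ) 1) : u * M.a u = M.falseRej u := by
  by_cases h : u = 0
  · have h1 := M.falseRej_nonneg hu
    have h2 := M.falseRej_le_self hu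
    rw [h] at h1 h2 ⊢
    linarith
  · rw [a, if_neg h, mul_div_cancel₀ _ h, falseRej]
    exact (M.integral_comp_Lfdr_mul_threshold measurable_id M.integrable_id_νW u).symm

theorem mul_b {u : ℝ} (hu : u ∈ Set.Icc (0 : ℝ) 1) : (1 - u) * M.b u = M.falseAcc u := by
  by_cases h : u = 1
  · have h1 := M.falseAcc_nonneg hu
    have h2 := M.falseAcc_le hu
    rw [h] at h1 h2 ⊢
    linarith
  · rw [b, if_neg h, mul_div_cancel₀ _ (sub_ne_zero.2 (Ne.symm h)),
      ← M.integral_accept_threshold hu]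
    have hi : Integrable (fun w : ℝ => 1 - w) M.νW := (integrable_const _).sub M.integrable_id_νW
    have e := M.integral_comp_Lfdr_mul_threshold (k := fun w => 1 - w) (by fun_prop) hi u
    have hw : Integrable (fun x => 1 - M.Lfdr x) M.Pmix :=
      (integrable_const _).sub M.integrable_Lfdr
    have hwt : Integrable (fun x => (1 - M.Lfdr x) * M.threshold u x) M.Pmix := by
      refine integrable_of_mem_Icc ((measurable_const.sub M.measurable_Lfdr).mul
        (M.measurable_threshold u)) fun x => ?_
      have h0 := M.Lfdr_nonneg x
      have h1 := M.Lfdr_le_one x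
      have ht := M.threshold_mem hu x
      exact ⟨mul_nonneg (by linarith) ht.1, mul_le_one₀ (by linarith) ht.1 ht.2⟩
    have s1 : ∫ x, (1 - M.Lfdr x) * (1 - M.threshold u x) ∂M.Pmix =
        ∫ w, (1 - w) ∂M.νW - ∫ x, (1 - M.Lfdr x) * M.threshold u x ∂M.Pmix := by
      have : ∫ w, (1 - w) ∂M.νW = ∫ x, (1 - M.Lfdr x) ∂M.Pmix :=
        integral_map M.measurable_Lfdr.aemeasurable hi.aestronglyMeasurable
      rw [this, ← integral_sub hw hwt]
      exact integral_congr_ae (ae_of_all _ fun x => by ring)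
    have s2 : ∫ w, (1 - w) ∂M.νW = (∫ w in Set.Iio (M.Ginv u), (1 - w) ∂M.νW) +
        ((1 - M.Ginv u) * M.atom (M.Ginv u)) +
        ∫ w in Set.Ioi (M.Ginv u), (1 - w) ∂M.νW := by
      rw [← integral_add_compl (measurableSet_Iic (a := M.Ginv u)) hi, Set.compl_Iic,
        ← Set.Iio_union_right, setIntegral_union (by simp) (measurableSet_singleton _)
        hi.integrableOn hi.integrableOn, integral_singleton]
      simp [atom, Measure.real, mul_comm]
    rw [s1, e, s2]
    ring

theorem falseRej_mul_le {u v : ℝ} (hu : u ∈ Set.Icc (0 : ℝ) 1) (hv : v ∈ Set.Icc (0 : ℝ) 1)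
    (huv : u ≤ v) : v * M.falseRej u ≤ u * M.falseRej v := by
  rcases eq_or_lt_of_le hv.1 with rfl | hv0
  · have : u = 0 := le_antisymm huv hu.1
    simp [this]
  have hc : u / v ∈ Set.Icc (0 : ℝ) 1 := ⟨div_nonneg hu.1 hv.1, (div_le_one hv0).2 huv⟩
  have h := M.falseRej_le hu (g := fun x => u / v * M.threshold v x)
    ((M.measurable_threshold v).const_mul _)
    (fun x => ⟨mul_nonneg hc.1 (M.threshold_mem hv x).1,
      mul_le_one₀ hc.2 (M.threshold_mem hv x).1 (M.threshold_mem hv x).2⟩)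
    (by rw [integral_const_mul, M.integral_threshold hv, div_mul_cancel₀ _ hv0.ne'])
  simp_rw [mul_left_comm _ (u / v)] at h
  rw [integral_const_mul] at h
  change M.falseRej u ≤ u / v * M.falseRej v at h
  rwa [div_mul_eq_mul_div, le_div_iff₀' hv0] at h

theorem falseAcc_mul_le {u v : ℝ} (hu : u ∈ Set.Icc (0 : ℝ) 1) (hv : v ∈ Set.Icc (0 : ℝ) 1)
    (huv : u ≤ v) : (1 - u) * M.falseAcc v ≤ (1 - v) * M.falseAcc u := by
  rcases eq_or_lt_of_le hu.2 with rfl | hu1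
  · have : v = 1 := le_antisymm hv.2 huv
    simp [this]
  have hu1' : 0 < 1 - u := sub_pos.2 hu1
  set c := (1 - v) / (1 - u) with hcdef
  have hc : c ∈ Set.Icc (0 : ℝ) 1 :=
    ⟨div_nonneg (sub_nonneg.2 hv.2) hu1'.le, (div_le_one hu1').2 (by linarith)⟩
  have hm : Measurable fun x => 1 - c * (1 - M.threshold u x) :=
    measurable_const.sub ((measurable_const.sub (M.measurable_threshold u)).const_mul _)
  have hmem : ∀ x, 1 - c * (1 - M.threshold u x) ∈ Set.Icc (0 : ℝ) 1 := fun x => by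
    have ht := M.threshold_mem hu x
    have h1 : c * (1 - M.threshold u x) ≤ 1 :=
      mul_le_one₀ hc.2 (sub_nonneg.2 ht.2) (by linarith [ht.1])
    have h2 : 0 ≤ c * (1 - M.threshold u x) := mul_nonneg hc.1 (sub_nonneg.2 ht.2)
    exact ⟨by linarith, by linarith⟩
  have hInt : ∫ x, (1 - c * (1 - M.threshold u x)) ∂M.Pmix = v := by
    have hti : Integrable (M.threshold u) M.Pmix :=
      integrable_of_mem_Icc (M.measurable_threshold u) (M.threshold_mem hu)
    have hti' : Integrable (fun x => 1 - M.threshold u x) M.Pmix := (integrable_const _).sub hti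
    rw [integral_sub (integrable_const _) (hti'.const_mul _), integral_const_mul,
      integral_sub (integrable_const _) hti, M.integral_threshold hu]
    simp only [integral_const, probReal_univ, smul_eq_mul, mul_one]
    rw [hcdef, div_mul_cancel₀ _ hu1'.ne']
    ring
  have h := M.falseRej_le hv hm hmem hInt
  have h2 := M.integral_accept hm hmem
  rw [hInt] at h2
  have h3 : ∫ x, (1 - M.Lfdr x) * (1 - (1 - c * (1 - M.threshold u x))) ∂M.Pmix =
      c * M.falseAcc u := by
    rw [← M.integral_accept_threshold hu, ← integral_const_mul]
    exact integral_congr_ae (ae_of_all _ fun x => by ring)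
  have h4 : M.falseAcc v ≤ c * M.falseAcc u := by
    unfold falseAcc at h3 ⊢
    linarith
  rwa [hcdef, div_mul_eq_mul_div, le_div_iff₀' hu1'] at h4

theorem b_one : M.b 1 = 0 := if_pos rfl

theorem b_nonneg {u : ℝ} (hu : u ∈ Set.Icc (0 : ℝ) 1) : 0 ≤ M.b u := by
  rcases eq_or_lt_of_le hu.2 with rfl | h
  · rw [b_one]
  · have h1 := M.falseAcc_nonneg hu
    rw [← M.mul_b hu] at h1
    exact nonneg_of_mul_nonneg_right h1 (sub_pos.2 h)

theorem b_le_of_le {u v : ℝ} (hu : u ∈ Set.Icc (0 : ℝ) 1) (hv : v ∈ Set.Icc (0 : ℝ) 1)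
    (huv : u ≤ v) : M.b v ≤ M.b u := by
  rcases eq_or_lt_of_le hv.2 with rfl | hv1
  · rw [b_one]
    exact M.b_nonneg hu
  · have h := M.falseAcc_mul_le hu hv huv
    rw [← M.mul_b hu, ← M.mul_b hv, mul_left_comm] at h
    have hu1 : u < 1 := huv.trans_lt hv1
    exact le_of_mul_le_mul_left (le_of_mul_le_mul_left h (sub_pos.2 hv1)) (sub_pos.2 hu1)

theorem b_le_iff {u y : ℝ} (hu : u ∈ Set.Icc (0 : ℝ) 1) (hy : 0 ≤ y) :
    M.b u ≤ y ↔ M.falseAcc u ≤ (1 - u) * y := by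
  rcases eq_or_lt_of_le hu.2 with rfl | h
  · have := M.mul_b hu
    simp only [sub_self, zero_mul] at this ⊢
    simp [b_one, hy, ← this]
  · rw [← M.mul_b hu, mul_le_mul_iff_of_pos_left (sub_pos.2 h)]

theorem a_zero : M.a 0 = 0 := if_pos rfl

theorem a_le_iff {u y : ℝ} (hu : u ∈ Set.Icc (0 : ℝ) 1) (hy : 0 ≤ y) :
    M.a u ≤ y ↔ M.falseRej u ≤ u * y := by
  rcases eq_or_lt_of_le hu.1 with rfl | h
  · have := M.mul_a hu
    simp only [zero_mul] at this ⊢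
    simp [a_zero, hy, ← this]
  · rw [← M.mul_a hu, mul_le_mul_iff_of_pos_left h]

theorem continuousOn_falseRej : ContinuousOn M.falseRej (Set.Icc 0 1) := by
  have key : ∀ u ∈ Set.Icc (0 : ℝ) 1, ∀ v ∈ Set.Icc (0 : ℝ) 1, u ≤ v →
      M.falseRej u ≤ M.falseRej v ∧ M.falseRej v - M.falseRej u ≤ v - u := by
    intro u hu v hv huv
    constructor
    · have h := M.falseRej_mul_le hu hv huv
      rcases eq_or_lt_of_le hv.1 with h0 | h0
      · have : u = v := by linarith [hu.1]
        rw [this]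
      · refine le_of_mul_le_mul_left (h.trans ?_) h0
        exact mul_le_mul_of_nonneg_right huv (M.falseRej_nonneg hv)
    · have h := M.falseAcc_mul_le hu hv huv
      have hle : M.falseAcc v ≤ M.falseAcc u := by
        rcases eq_or_lt_of_le hu.2 with h0 | h0
        · have : u = v := by linarith [hv.2]
          rw [this]
        · refine le_of_mul_le_mul_left (h.trans ?_) (sub_pos.2 h0)
          exact mul_le_mul_of_nonneg_right (by linarith) (M.falseAcc_nonneg hu)
      unfold falseAcc at hle
      linarith
  refine (LipschitzOnWith.of_dist_le_mul (K := 1) fun u hu v hv => ?_).continuousOn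
  rw [NNReal.coe_one, one_mul, Real.dist_eq, Real.dist_eq]
  rcases le_total u v with h | h
  · have := key u hu v hv h
    rw [abs_sub_comm, abs_sub_comm u, abs_of_nonneg (by linarith), abs_of_nonneg (by linarith)]
    exact this.2
  · have := key v hv u hu h
    rw [abs_of_nonneg (by linarith), abs_of_nonneg (by linarith)]
    exact this.2

theorem continuousOn_falseAcc : ContinuousOn M.falseAcc (Set.Icc 0 1) :=
  (continuousOn_const.sub continuousOn_id).add M.continuousOn_falseRej

theorem isCompact_setOf_a_le {α : ℝ} (hα : 0 ≤ α) :
    IsCompact {u | u ∈ Set.Icc (0 : ℝ) 1 ∧ M.a u ≤ α} := by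
  have e : {u | u ∈ Set.Icc (0 : ℝ) 1 ∧ M.a u ≤ α} =
      Set.Icc 0 1 ∩ (fun u => M.falseRej u - u * α) ⁻¹' Set.Iic 0 := by
    ext u
    simp only [Set.mem_ofPred_eq, Set.mem_inter_iff, Set.mem_preimage, Set.mem_Iic, sub_nonpos]
    exact and_congr_right fun hu => M.a_le_iff hu hα
  rw [e]
  refine isCompact_Icc.of_isClosed_subset ?_ Set.inter_subset_left
  exact (M.continuousOn_falseRej.sub (by fun_prop)).preimage_isClosed_of_isClosed
    isClosed_Icc isClosed_Iic

theorem isGreatest_ustar {α : ℝ} (hα : 0 ≤ α) :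
    IsGreatest {u | u ∈ Set.Icc (0 : ℝ) 1 ∧ M.a u ≤ α} (M.ustar α) :=
  (M.isCompact_setOf_a_le hα).isGreatest_sSup ⟨0, by simp, by rwa [a_zero]⟩

theorem lowerSemicontinuousOn_b_ustar :
    LowerSemicontinuousOn (fun α => M.b (M.ustar α)) (Set.Icc 0 1) := by
  rw [lowerSemicontinuousOn_iff_preimage_Iic]
  intro y
  by_cases hy : 0 ≤ y
  swap
  · refine ⟨∅, isClosed_empty, ?_⟩
    ext α
    simp only [Set.mem_inter_iff, Set.mem_preimage, Set.mem_Iic, Set.inter_empty,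
      Set.mem_empty_iff_false, iff_false, not_and, not_le]
    intro hα
    exact (not_le.1 hy).trans_le (M.b_nonneg (M.isGreatest_ustar hα.1).1.1)
  set K : Set (ℝ × ℝ) := (Set.Icc 0 1 ×ˢ Set.Icc 0 1) ∩
    ((fun p => (M.falseRej p.2 - p.2 * p.1, M.falseAcc p.2 - (1 - p.2) * y)) ⁻¹'
      (Set.Iic 0 ×ˢ Set.Iic 0)) with hK
  have hKc : IsCompact K := by
    refine (isCompact_Icc.prod isCompact_Icc).of_isClosed_subset ?_ Set.inter_subset_left
    refine ContinuousOn.preimage_isClosed_of_isClosed (ContinuousOn.prodMk ?_ ?_)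
      (isClosed_Icc.prod isClosed_Icc) (isClosed_Iic.prod isClosed_Iic)
    · exact (M.continuousOn_falseRej.comp continuousOn_snd fun p hp => hp.2).sub (by fun_prop)
    · exact (M.continuousOn_falseAcc.comp continuousOn_snd fun p hp => hp.2).sub (by fun_prop)
  refine ⟨Prod.fst '' K, (hKc.image continuous_fst).isClosed, ?_⟩
  ext α
  simp only [Set.mem_inter_iff, Set.mem_preimage, Set.mem_Iic, Set.mem_image]
  refine and_congr_right fun hα => ?_
  have hg := M.isGreatest_ustar hα.1
  constructor
  · intro h
    refine ⟨(α, M.ustar α), ⟨⟨hα, hg.1.1⟩, ?_, ?_⟩, rfl⟩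
    · exact sub_nonpos.2 ((M.a_le_iff hg.1.1 hα.1).1 hg.1.2)
    · exact sub_nonpos.2 ((M.b_le_iff hg.1.1 hy).1 h)
  · rintro ⟨⟨α', u⟩, ⟨⟨_, hu⟩, h1, h2⟩, rfl⟩
    have h1' : M.a u ≤ α' := (M.a_le_iff hu hα.1).2 (sub_nonpos.1 h1)
    have h2' : M.b u ≤ y := (M.b_le_iff hu hy).2 (sub_nonpos.1 h2)
    exact (M.b_le_of_le hu hg.1.1 (hg.2 ⟨hu, h1'⟩)).trans h2'

theorem ustar_one : M.ustar 1 = 1 := by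
  have hg := M.isGreatest_ustar zero_le_one
  refine le_antisymm hg.1.1.2 (hg.2 ⟨by simp, ?_⟩)
  rw [M.a_le_iff (by simp) zero_le_one]
  simpa using M.falseRej_le_self (u := 1) (by simp)

end Model

theorem bern_apply {p : ℝ} (s : Set Bool) : bern p s =
    ENNReal.ofReal p * Measure.dirac true s + ENNReal.ofReal (1 - p) * Measure.dirac false s := by
  simp [bern]

theorem isProbabilityMeasure_bern {p : ℝ} (hp : p ∈ Set.Icc (0 : ℝ) 1) :
    IsProbabilityMeasure (bern p) := by
  refine ⟨?_⟩
  rw [bern_apply, measure_univ, measure_univ, mul_one, mul_one,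
    ← ENNReal.ofReal_add hp.1 (sub_nonneg.2 hp.2)]
  simp

theorem bern_real_singleton {p : ℝ} (hp : p ∈ Set.Icc (0 : ℝ) 1) (b : Bool) :
    (bern p).real {b} = if b then p else 1 - p := by
  rw [Measure.real, bern_apply]
  cases b
  · simp [ENNReal.toReal_ofReal (sub_nonneg.2 hp.2)]
  · simp [ENNReal.toReal_ofReal hp.1]

theorem measurable_bern : Measurable bern := by
  refine Measure.measurable_of_measurable_coe _ fun s _ => ?_
  simp_rw [bern_apply]
  fun_prop

theorem FDP_eq {n : ℕ} (θ d : Fin n → Bool) : FDP θ d =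
    ∑ i, (if d i = true then (1 : ℝ) else 0) / max 1 (∑ i, if d i = true then (1 : ℝ) else 0) *
      (if θ i = true then 0 else 1) := by
  simp only [FDP, nFD, nRej, Finset.sum_div]
  exact Finset.sum_congr rfl fun i _ => by ring

theorem FNP_eq {n : ℕ} (θ d : Fin n → Bool) : FNP θ d =
    ∑ i, (if d i = false then (1 : ℝ) else 0) / max 1 (∑ i, if d i = false then (1 : ℝ) else 0) *
      (if θ i = false then 0 else 1) := by
  have e : ∀ b : Bool, (if b = false then (1 : ℝ) else 0) = if b then 0 else 1 := by
    intro b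
    cases b <;> simp
  have e' : ∀ b : Bool, (if b = false then (0 : ℝ) else 1) = if b then 1 else 0 := by
    intro b
    cases b <;> simp
  simp only [FNP, nFN, nAcc, Finset.sum_div, e, e']
  exact Finset.sum_congr rfl fun i _ => by ring

theorem sum_div_max_one_eq {n : ℕ} (A : Bool) (d : Fin n → Bool) :
    (∑ i, if d i = A then (1 : ℝ) else 0) / max 1 (∑ i, if d i = A then (1 : ℝ) else 0) =
      1 - if d = (fun _ => !A) then 1 else 0 := by
  by_cases h : d = fun _ => !A
  · subst h
    simp
  · obtain ⟨i, hi⟩ : ∃ i, d i ≠ !A := by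
      by_contra! hc
      exact h (funext hc)
    have hi' : d i = A := by
      revert hi
      cases d i <;> cases A <;> simp
    have h1 : (1 : ℝ) ≤ ∑ i, if d i = A then (1 : ℝ) else 0 := by
      have := Finset.single_le_sum (f := fun i => if d i = A then (1 : ℝ) else 0)
        (fun j _ => by split_ifs <;> simp) (Finset.mem_univ i)
      simpa [hi'] using this
    rw [max_eq_right h1, div_self (by linarith), if_neg h, sub_zero]

theorem sum_prod_mul_indicator {n : ℕ} (A : Bool) {V : Bool → ℝ} (hV : V A + V (!A) = 1) :
    ∑ d : Fin n → Bool, (1 - if d = (fun _ => !A) then (1 : ℝ) else 0) * ∏ j, V (d j) =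
      1 - (1 - V A) ^ n := by
  have h1 : ∑ d : Fin n → Bool, ∏ j, V (d j) = 1 := by
    have := Finset.prod_univ_sum (fun _ : Fin n => (Finset.univ : Finset Bool)) (fun _ b => V b)
    rw [Fintype.piFinset_univ] at this
    rw [← this]
    refine Finset.prod_eq_one fun i _ => ?_
    rw [Fintype.sum_bool]
    cases A
    · rw [add_comm]
      exact hV
    · exact hV
  have h2 : V (!A) = 1 - V A := by linarith
  simp only [sub_mul, one_mul, ite_mul, zero_mul, Finset.sum_sub_distrib, h1]
  simp [h2]

namespace Model

variable {𝒳 : Type*} [MeasurableSpace 𝒳] (M : Model 𝒳)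

/-- Under independent randomized tests, the expected proportion of errors among the hypotheses
receiving the decision `A` is the conditional probability of an error given the decision `A`
times the probability that the decision `A` is made at least once. -/
theorem integral_error_proportion (n : ℕ) (A : Bool) {q : 𝒳 → ℝ} (hq : Measurable q)
    (h : ∀ x, q x ∈ Set.Icc (0 : ℝ) 1) {v c : ℝ}
    (hv : ∫ x, (if A then q x else 1 - q x) ∂M.Pmix = v)
    (hc : ∫ z, (if z.1 = A then 0 else 1) * (if A then q z.2 else 1 - q z.2) ∂M.joint = c * v) :
    Integrable (fun ω : Fin n → Bool × 𝒳 => ∫ d : Fin n → Bool,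
      ∑ i, (if d i = A then (1 : ℝ) else 0) / max 1 (∑ i, if d i = A then (1 : ℝ) else 0) *
        (if (ω i).1 = A then 0 else 1) ∂(Measure.pi fun i => bern (q (ω i).2))) (M.jointN n) ∧
    ∫ ω, ∫ d : Fin n → Bool,
      ∑ i, (if d i = A then (1 : ℝ) else 0) / max 1 (∑ i, if d i = A then (1 : ℝ) else 0) *
        (if (ω i).1 = A then 0 else 1) ∂(Measure.pi fun i => bern (q (ω i).2)) ∂(M.jointN n) =
      c * (1 - (1 - v) ^ n) := by
  set w : Bool → Bool × 𝒳 → ℝ := fun b z => if b then q z.2 else 1 - q z.2 with hw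
  set g : Fin n → (Fin n → Bool) → Fin n → Bool × 𝒳 → ℝ := fun i d j z =>
    (if j = i then (if z.1 = A then 0 else 1) else 1) * w (d j) z with hg
  set T : (Fin n → Bool) → ℝ := fun d => max 1 (∑ i, if d i = A then (1 : ℝ) else 0) 
  have hwm : ∀ b, Measurable (w b) := by
    intro b
    have : Measurable fun z : Bool × 𝒳 => q z.2 := hq.comp measurable_snd
    cases b
    · have : Measurable fun z : Bool × 𝒳 => 1 - q z.2 := measurable_const.sub this
      simpa [hw] using this
    · simpa [hw] using this
  have hwmem : ∀ b z, w b z ∈ Set.Icc (0 : ℝ) 1 := by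
    intro b z
    have := h z.2
    cases b
    · simpa [hw, and_comm] using this
    · simpa [hw] using this
  have herr : Measurable fun z : Bool × 𝒳 => if z.1 = A then (0 : ℝ) else 1 :=
    (measurable_of_countable fun b : Bool => if b = A then (0 : ℝ) else 1).comp measurable_fst
  have hgm : ∀ i d j, Measurable (g i d j) := by
    intro i d j
    refine Measurable.mul ?_ (hwm _)
    split_ifs
    · exact herr
    · exact measurable_const
  have hgi : ∀ i d j, Integrable (g i d j) M.joint := fun i d j =>
    integrable_of_mem_Icc (hgm i d j) fun z => by
      simp only [hg]
      have := hwmem (d j) z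
      split_ifs
      · simp
      · simpa using this
      · simpa using this
  have hV : ∀ b, ∫ z, w b z ∂M.joint = ∫ x, (if b then q x else 1 - q x) ∂M.Pmix := by
    intro b
    rw [M.integral_joint (hwm b) (C := 1) fun z => by
      rw [Real.norm_of_nonneg (hwmem b z).1]
      exact (hwmem b z).2]
    refine integral_congr_ae (ae_of_all _ fun x => ?_)
    simp only [hw]
    ring
  have hVA : ∫ z, w A z ∂M.joint = v := (hV A).trans hv
  have hVsum : ∫ z, w A z ∂M.joint + ∫ z, w (!A) z ∂M.joint = 1 := by
    have i : ∀ b, Integrable (w b) M.joint := fun b => integrable_of_mem_Icc (hwm b) (hwmem b)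
    rw [← integral_add (i _) (i _)]
    have : ∀ z, w A z + w (!A) z = 1 := fun z => by cases A <;> simp [hw]
    simp [this]
  have hprod : ∀ i d, d i = A → ∏ j, ∫ z, g i d j z ∂M.joint =
      c * ∏ j, ∫ z, w (d j) z ∂M.joint := by
    intro i d hd
    have : ∀ j, ∫ z, g i d j z ∂M.joint =
        (if j = i then c else 1) * ∫ z, w (d j) z ∂M.joint := by
      intro j
      by_cases hj : j = i
      · subst hj
        simp only [hg, if_true, hd, hVA]
        exact hc
      · simp [hg, hj]
    simp_rw [this]
    rw [Finset.prod_mul_distrib, Finset.prod_ite_eq' Finset.univ i, if_pos (Finset.mem_univ i)]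
  have hinner : ∀ ω : Fin n → Bool × 𝒳, ∫ d : Fin n → Bool,
      ∑ i, (if d i = A then (1 : ℝ) else 0) / max 1 (∑ i, if d i = A then (1 : ℝ) else 0) *
        (if (ω i).1 = A then 0 else 1) ∂(Measure.pi fun i => bern (q (ω i).2)) =
      ∑ d : Fin n → Bool, ∑ i, (if d i = A then (1 : ℝ) else 0) / T d * ∏ j, g i d j (ω j) := by
    intro ω
    have : ∀ i, IsProbabilityMeasure (bern (q (ω i).2)) := fun i =>
      isProbabilityMeasure_bern (h _)
    rw [integral_fintype (Integrable.of_finite)]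
    refine Finset.sum_congr rfl fun d _ => ?_
    have e : (Measure.pi fun i => bern (q (ω i).2)).real {d} = ∏ j, w (d j) (ω j) := by
      rw [Measure.real, Measure.pi_singleton, ENNReal.toReal_prod]
      exact Finset.prod_congr rfl fun j _ => bern_real_singleton (h _) _
    rw [e, smul_eq_mul, Finset.mul_sum]
    refine Finset.sum_congr rfl fun i _ => ?_
    simp only [hg]
    rw [Finset.prod_mul_distrib, Finset.prod_ite_eq' Finset.univ i, if_pos (Finset.mem_univ i)]
    ring
  have hInt : ∀ i d, Integrable (fun ω : Fin n → Bool × 𝒳 =>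
      (if d i = A then (1 : ℝ) else 0) / T d * ∏ j, g i d j (ω j)) (M.jointN n) := fun i d =>
    (Integrable.fintype_prod fun j => hgi i d j).const_mul _
  simp_rw [hinner]
  refine ⟨integrable_finsetSum _ fun d _ => integrable_finsetSum _ fun i _ => hInt i d, ?_⟩
  rw [integral_finsetSum _ fun d _ => integrable_finsetSum _ fun i _ => hInt i d]
  have hd : ∀ d : Fin n → Bool, ∫ ω, ∑ i, (if d i = A then (1 : ℝ) else 0) / T d *
      ∏ j, g i d j (ω j) ∂(M.jointN n) =
      c * ((1 - if d = (fun _ => !A) then (1 : ℝ) else 0) * ∏ j, ∫ z, w (d j) z ∂M.joint) := by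
    intro d
    have hTd : (∑ i, if d i = A then (1 : ℝ) else 0) / T d =
      1 - if d = (fun _ => !A) then 1 else 0 := sum_div_max_one_eq A d
    rw [integral_finsetSum _ fun i _ => hInt i d, ← hTd, Finset.sum_div,
      Finset.sum_mul, Finset.mul_sum]
    refine Finset.sum_congr rfl fun i _ => ?_
    rw [integral_const_mul, jointN, integral_fintype_prod_eq_prod]
    by_cases hdi : d i = A
    · rw [hprod i d hdi]
      ring
    · simp [hdi]
  simp_rw [hd]
  rw [← Finset.mul_sum, sum_prod_mul_indicator A (V := fun b => ∫ z, w b z ∂M.joint) hVsum, hVA]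

theorem integral_joint_reject {q : 𝒳 → ℝ} (hq : Measurable q)
    (h : ∀ x, q x ∈ Set.Icc (0 : ℝ) 1) :
    ∫ z, (if z.1 = true then 0 else 1) * q z.2 ∂M.joint = ∫ x, M.Lfdr x * q x ∂M.Pmix := by
  have herr : Measurable fun z : Bool × 𝒳 => if z.1 = true then (0 : ℝ) else 1 :=
    (measurable_of_countable fun b : Bool => if b = true then (0 : ℝ) else 1).comp measurable_fst
  have hm : Measurable fun z : Bool × 𝒳 => (if z.1 = true then (0 : ℝ) else 1) * q z.2 :=
    herr.mul (hq.comp measurable_snd)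
  rw [M.integral_joint hm (C := 1)]
  · simp
  · intro z
    have := h z.2
    split_ifs
    · simp
    · simpa [abs_of_nonneg this.1] using this.2

theorem integral_joint_accept {q : 𝒳 → ℝ} (hq : Measurable q)
    (h : ∀ x, q x ∈ Set.Icc (0 : ℝ) 1) :
    ∫ z, (if z.1 = false then 0 else 1) * (1 - q z.2) ∂M.joint =
      ∫ x, (1 - M.Lfdr x) * (1 - q x) ∂M.Pmix := by
  have herr : Measurable fun z : Bool × 𝒳 => if z.1 = false then (0 : ℝ) else 1 :=
    (measurable_of_countable fun b : Bool => if b = false then (0 : ℝ) else 1).comp measurable_fst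
  have hm : Measurable fun z : Bool × 𝒳 => (if z.1 = false then (0 : ℝ) else 1) * (1 - q z.2) :=
    herr.mul (measurable_const.sub (hq.comp measurable_snd))
  rw [M.integral_joint hm (C := 1)]
  · simp
  · intro z
    have := h z.2
    split_ifs
    · simp
    · simpa [abs_of_nonneg (sub_nonneg.2 this.2)] using this.1

theorem integral_FDP_NP {α : ℝ} (hα : 0 ≤ α) (n : ℕ) :
    Integrable (fun ω : Fin n → Bool × 𝒳 =>
      ∫ d, FDP (fun i => (ω i).1) d ∂(M.NP α n fun i => (ω i).2)) (M.jointN n) ∧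
    ∫ ω, ∫ d, FDP (fun i => (ω i).1) d ∂(M.NP α n fun i => (ω i).2) ∂(M.jointN n) =
      M.a (M.ustar α) * (1 - (1 - M.ustar α) ^ n) := by
  have hu := (M.isGreatest_ustar hα).1.1
  simp_rw [FDP_eq]
  refine M.integral_error_proportion n true (M.measurable_threshold _) (M.threshold_mem hu) ?_ ?_
  · simpa using M.integral_threshold hu
  · simp only [if_true]
    rw [M.integral_joint_reject (M.measurable_threshold _) (M.threshold_mem hu), mul_comm,
      M.mul_a hu]
    rfl

theorem integral_FNP_NP {α : ℝ} (hα : 0 ≤ α) (n : ℕ) :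
    Integrable (fun ω : Fin n → Bool × 𝒳 =>
      ∫ d, FNP (fun i => (ω i).1) d ∂(M.NP α n fun i => (ω i).2)) (M.jointN n) ∧
    ∫ ω, ∫ d, FNP (fun i => (ω i).1) d ∂(M.NP α n fun i => (ω i).2) ∂(M.jointN n) =
      M.b (M.ustar α) * (1 - M.ustar α ^ n) := by
  have hu := (M.isGreatest_ustar hα).1.1
  have hti : Integrable (M.threshold (M.ustar α)) M.Pmix :=
    integrable_of_mem_Icc (M.measurable_threshold _) (M.threshold_mem hu)
  simp_rw [FNP_eq]
  have key := M.integral_error_proportion n false (v := 1 - M.ustar α) (c := M.b (M.ustar α))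
    (M.measurable_threshold (M.ustar α)) (M.threshold_mem hu) ?_ ?_
  · rw [sub_sub_cancel] at key
    exact key
  · simp only [Bool.false_eq_true, if_false]
    rw [integral_sub (integrable_const _) hti, M.integral_threshold hu]
    simp
  · simp only [Bool.false_eq_true, if_false]
    rw [M.integral_joint_accept (M.measurable_threshold _) (M.threshold_mem hu), mul_comm,
      M.mul_b hu, M.integral_accept_threshold hu]

theorem measurable_rejection_probability {κ : (Fin 1 → 𝒳) → Measure (Fin 1 → Bool)}
    (hκ : IsRule κ) : Measurable fun x : 𝒳 => (κ fun _ => x).real {d | d 0 = true} := by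
  refine Measurable.ennreal_toReal ?_
  refine (Measure.measurable_coe (Set.toFinite _).measurableSet).comp (hκ.1.comp ?_)
  exact measurable_pi_lambda _ fun _ => measurable_id

theorem rejection_probability_mem {κ : (Fin 1 → 𝒳) → Measure (Fin 1 → Bool)}
    (hκ : IsRule κ) (x : 𝒳) : (κ fun _ => x).real {d | d 0 = true} ∈ Set.Icc (0 : ℝ) 1 := by
  have := hκ.2 fun _ => x
  exact ⟨measureReal_nonneg, measureReal_le_one⟩

theorem integral_single_decision {κ : (Fin 1 → 𝒳) → Measure (Fin 1 → Bool)} (hκ : IsRule κ)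
    {φ : 𝒳 → ℝ} (hφ : ∀ x, (κ fun _ => x).real {d | d 0 = true} = φ x) (H : Bool → Bool → ℝ) :
    ∫ ω, ∫ d, H (ω 0).1 (d 0) ∂(κ fun i => (ω i).2) ∂(M.jointN 1) =
      ∫ x, (M.Lfdr x * (H false true * φ x + H false false * (1 - φ x)) +
        (1 - M.Lfdr x) * (H true true * φ x + H true false * (1 - φ x))) ∂M.Pmix := by
  have hm : Measurable φ := by
    have := measurable_rejection_probability hκ
    simp_rw [hφ] at this
    exact this
  have hmem : ∀ x, φ x ∈ Set.Icc (0 : ℝ) 1 := fun x => by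
    rw [← hφ]
    exact rejection_probability_mem hκ x
  set F : Bool × 𝒳 → ℝ := fun z => H z.1 true * φ z.2 + H z.1 false * (1 - φ z.2) with hF
  have hHm : ∀ b, Measurable fun z : Bool × 𝒳 => H z.1 b := fun b =>
    (measurable_of_countable fun θ => H θ b).comp measurable_fst
  have hm' : Measurable fun z : Bool × 𝒳 => φ z.2 := hm.comp measurable_snd
  have hFm : Measurable F :=
    ((hHm true).mul hm').add ((hHm false).mul (measurable_const.sub hm'))
  have inner : ∀ ω : Fin 1 → Bool × 𝒳,
      ∫ d, H (ω 0).1 (d 0) ∂(κ fun i => (ω i).2) = F (ω 0) := by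
    intro ω
    have hx : (fun i => (ω i).2) = fun _ => (ω 0).2 := by
      ext i
      rw [Subsingleton.elim i 0]
    rw [hx]
    have := hκ.2 fun _ => (ω 0).2
    set μ := κ fun _ => (ω 0).2 with hμ
    have hR : MeasurableSet {d : Fin 1 → Bool | d 0 = true} := (Set.toFinite _).measurableSet
    have hi : Integrable ({d : Fin 1 → Bool | d 0 = true}.indicator (fun _ => (1 : ℝ))) μ :=
      (integrable_const _).indicator hR
    have e : ∀ d : Fin 1 → Bool, H (ω 0).1 (d 0) = H (ω 0).1 false +
        (H (ω 0).1 true - H (ω 0).1 false) *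
          {d : Fin 1 → Bool | d 0 = true}.indicator (fun _ => (1 : ℝ)) d := by
      intro d
      by_cases hd : d 0 = true
      · simp [hd]
      · simp [hd]
    simp_rw [e]
    rw [integral_add (integrable_const _) (hi.const_mul _), integral_const_mul,
      integral_indicator_const _ hR, hμ, hφ]
    simp only [integral_const, probReal_univ, smul_eq_mul, one_mul, mul_one, hF]
    ring
  simp_rw [inner]
  have hmap : ∫ ω, F (ω 0) ∂(M.jointN 1) = ∫ z, F z ∂M.joint := by
    have hp := measurePreserving_eval (fun _ : Fin 1 => M.joint) 0
    conv_rhs => rw [← hp.map_eq]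
    rw [integral_map hp.measurable.aemeasurable hFm.aestronglyMeasurable]
    rfl
  obtain ⟨C, hC⟩ : ∃ C, ∀ p : Bool × Bool, ‖H p.1 p.2‖ ≤ C :=
    ⟨∑ p : Bool × Bool, ‖H p.1 p.2‖, fun p =>
      Finset.single_le_sum (f := fun p : Bool × Bool => ‖H p.1 p.2‖)
        (fun _ _ => norm_nonneg _) (Finset.mem_univ p)⟩
  rw [hmap, M.integral_joint hFm (C := C)]
  intro z
  have hz := hmem z.2
  have h1 := abs_le.1 (hC (z.1, true))
  have h2 := abs_le.1 (hC (z.1, false))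
  refine abs_le.2 ⟨?_, ?_⟩ <;> simp only [hF] <;> nlinarith [hz.1, hz.2, h1.1, h1.2, h2.1, h2.2]

theorem mFDR_one_eq {κ : (Fin 1 → 𝒳) → Measure (Fin 1 → Bool)} (hκ : IsRule κ)
    {φ : 𝒳 → ℝ} (hφ : ∀ x, (κ fun _ => x).real {d | d 0 = true} = φ x) :
    M.mFDR 1 κ = (∫ x, M.Lfdr x * φ x ∂M.Pmix) / ∫ x, φ x ∂M.Pmix := by
  have h1 := M.integral_single_decision hκ hφ
    fun θ d => (if d then 1 else 0) * (if θ then 0 else 1)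
  have h2 := M.integral_single_decision hκ hφ fun _ d => if d then 1 else 0
  simp only [mFDR, nFD, nRej, Fin.sum_univ_one]
  rw [h1, h2]
  congr 1
  · simp
  · exact integral_congr_ae (ae_of_all _ fun x => by simp; ring)

theorem mFNR_one_eq {κ : (Fin 1 → 𝒳) → Measure (Fin 1 → Bool)} (hκ : IsRule κ)
    {φ : 𝒳 → ℝ} (hφ : ∀ x, (κ fun _ => x).real {d | d 0 = true} = φ x) :
    M.mFNR 1 κ = (∫ x, (1 - M.Lfdr x) * (1 - φ x) ∂M.Pmix) / ∫ x, (1 - φ x) ∂M.Pmix := by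
  have h1 := M.integral_single_decision hκ hφ
    fun θ d => (if d then 0 else 1) * (if θ then 1 else 0)
  have h2 := M.integral_single_decision hκ hφ fun _ d => if d then 0 else 1
  simp only [mFNR, nFN, nAcc, Fin.sum_univ_one]
  rw [h1, h2]
  congr 1
  · simp
  · exact integral_congr_ae (ae_of_all _ fun x => by simp; ring)

theorem exists_isRule_rejection_probability {q : 𝒳 → ℝ} (hq : Measurable q)
    (h : ∀ x, q x ∈ Set.Icc (0 : ℝ) 1) : ∃ κ : (Fin 1 → 𝒳) → Measure (Fin 1 → Bool),
      IsRule κ ∧ ∀ x, (κ fun _ => x).real {d | d 0 = true} = q x := by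
  have hc : Measurable fun (b : Bool) (_ : Fin 1) => b := measurable_of_countable _
  refine ⟨fun x => (bern (q (x 0))).map fun b _ => b, ⟨?_, fun x => ?_⟩, fun x => ?_⟩
  · exact (Measure.measurable_map _ hc).comp
      (measurable_bern.comp (hq.comp (measurable_pi_apply 0)))
  · have := isProbabilityMeasure_bern (h (x 0))
    exact Measure.isProbabilityMeasure_map hc.aemeasurable
  · rw [map_measureReal_apply hc (Set.toFinite _).measurableSet]
    have := bern_real_singleton (h x) true
    simpa using this

/-- The optimal marginal false non-discovery rate is attained by thresholding the local false
discovery rate. -/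
theorem mFNRstar_eq {α : ℝ} (hα : 0 ≤ α) : M.mFNRstar α = M.b (M.ustar α) := by
  have hg := M.isGreatest_ustar hα
  have hu := hg.1.1
  refine IsLeast.csInf_eq ⟨?_, ?_⟩
  · obtain ⟨κ, hκ, hφ⟩ := exists_isRule_rejection_probability
      (M.measurable_threshold (M.ustar α)) (M.threshold_mem hu)
    have hti : Integrable (M.threshold (M.ustar α)) M.Pmix :=
      integrable_of_mem_Icc (M.measurable_threshold _) (M.threshold_mem hu)
    refine ⟨κ, hκ, ?_, ?_⟩
    · rw [M.mFDR_one_eq hκ hφ, M.integral_threshold hu]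
      change M.falseRej _ / _ ≤ _
      have := (M.a_le_iff hu hα).1 hg.1.2
      exact div_le_of_le_mul₀ hu.1 hα (by rwa [mul_comm])
    · rw [M.mFNR_one_eq hκ hφ, M.integral_accept_threshold hu,
        integral_sub (integrable_const _) hti, M.integral_threshold hu]
      simp only [integral_const, probReal_univ, smul_eq_mul, mul_one]
      rcases eq_or_lt_of_le hu.2 with h1 | h1
      · simp [h1, b_one]
      · rw [← M.mul_b hu, mul_div_cancel_left₀ _ (sub_pos.2 h1).ne']
  · rintro _ ⟨κ, hκ, hle, rfl⟩
    obtain ⟨φ, hφ⟩ : ∃ φ : 𝒳 → ℝ, ∀ x, (κ fun _ => x).real {d | d 0 = true} = φ x :=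
      ⟨_, fun _ => rfl⟩
    have hm : Measurable φ := by
      have := measurable_rejection_probability hκ
      simp_rw [hφ] at this
      exact this
    have hmem : ∀ x, φ x ∈ Set.Icc (0 : ℝ) 1 := fun x => by
      rw [← hφ]
      exact rejection_probability_mem hκ x
    have e1 := M.mFDR_one_eq hκ hφ
    have e2 := M.mFNR_one_eq hκ hφ
    have hφi : Integrable φ M.Pmix := integrable_of_mem_Icc hm hmem
    have hv : ∫ x, φ x ∂M.Pmix ∈ Set.Icc (0 : ℝ) 1 := by
      refine ⟨integral_nonneg fun x => (hmem x).1, ?_⟩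
      simpa using integral_mono hφi (integrable_const 1) fun x => (hmem x).2
    have hacc := M.integral_accept hm hmem
    have hopt := M.falseRej_le hv hm hmem rfl
    have hL : ∫ x, M.Lfdr x * φ x ∂M.Pmix ≤ ∫ x, φ x ∂M.Pmix :=
      integral_mono (M.integrable_Lfdr_mul hm hmem) hφi fun x =>
        mul_le_of_le_one_left (hmem x).1 (M.Lfdr_le_one x)
    rw [e2, hacc, integral_sub (integrable_const _) hφi]
    simp only [integral_const, probReal_univ, smul_eq_mul, mul_one]
    rw [e1] at hle
    generalize ∫ x, φ x ∂M.Pmix = v at *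
    have ha : M.a v ≤ α := by
      rw [M.a_le_iff hv hα]
      rcases eq_or_lt_of_le hv.1 with h0 | h0
      · rw [← h0] at hL hopt ⊢
        linarith
      · rw [div_le_iff₀ h0] at hle
        linarith
    refine (M.b_le_of_le hv hu (hg.2 ⟨hv, ha⟩)).trans ?_
    rcases eq_or_lt_of_le hv.2 with h1 | h1
    · simp [h1, b_one]
    · rw [le_div_iff₀ (sub_pos.2 h1), mul_comm, M.mul_b hv, falseAcc]
      linarith

theorem FDR_NP_le {α : ℝ} (hα : 0 ≤ α) (n : ℕ) : M.FDR n (M.NP α n) ≤ α := by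
  have hg := M.isGreatest_ustar hα
  have h0 : 0 ≤ 1 - M.ustar α := sub_nonneg.2 hg.1.1.2
  have h1 : 1 - M.ustar α ≤ 1 := by linarith [hg.1.1.1]
  have hp : 0 ≤ (1 - M.ustar α) ^ n := pow_nonneg h0 n
  have hp1 : (1 - M.ustar α) ^ n ≤ 1 := pow_le_one₀ h0 h1
  rw [FDR, (M.integral_FDP_NP hα n).2]
  exact (mul_le_mul_of_nonneg_right hg.1.2 (by linarith)).trans
    (mul_le_of_le_one_right hα (by linarith))

theorem tendsto_FNR_NP {α : ℝ} (hα : 0 ≤ α) :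
    Tendsto (fun n => M.FNR n (M.NP α n)) atTop (nhds (M.mFNRstar α)) := by
  have hu := (M.isGreatest_ustar hα).1.1
  have e : ∀ n, M.FNR n (M.NP α n) = M.b (M.ustar α) * (1 - M.ustar α ^ n) := fun n =>
    (M.integral_FNP_NP hα n).2
  simp_rw [e]
  rw [M.mFNRstar_eq hα]
  rcases eq_or_lt_of_le hu.2 with h | h
  · simp [h, b_one]
  · have := ((tendsto_pow_atTop_nhds_zero_of_lt_one hu.1 h).const_sub 1).const_mul
      (M.b (M.ustar α))
    simpa using this

/-- Expectations under a rule which randomizes between two rules. -/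
theorem integral_mixture {n : ℕ} {κ₁ κ₂ : (Fin n → 𝒳) → Measure (Fin n → Bool)}
    (h₁ : ∀ x, IsFiniteMeasure (κ₁ x)) (h₂ : ∀ x, IsFiniteMeasure (κ₂ x))
    {c₁ c₂ : ℝ} (hc₁ : 0 ≤ c₁) (hc₂ : 0 ≤ c₂)
    (L : (Fin n → Bool) → (Fin n → Bool) → ℝ)
    (hL₁ : Integrable (fun ω : Fin n → Bool × 𝒳 =>
      ∫ d, L (fun i => (ω i).1) d ∂(κ₁ fun i => (ω i).2)) (M.jointN n))
    (hL₂ : Integrable (fun ω : Fin n → Bool × 𝒳 =>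
      ∫ d, L (fun i => (ω i).1) d ∂(κ₂ fun i => (ω i).2)) (M.jointN n)) :
    ∫ ω, ∫ d, L (fun i => (ω i).1) d ∂(ENNReal.ofReal c₁ • κ₁ (fun i => (ω i).2) +
        ENNReal.ofReal c₂ • κ₂ (fun i => (ω i).2)) ∂(M.jointN n) =
      c₁ * ∫ ω, ∫ d, L (fun i => (ω i).1) d ∂(κ₁ fun i => (ω i).2) ∂(M.jointN n) +
      c₂ * ∫ ω, ∫ d, L (fun i => (ω i).1) d ∂(κ₂ fun i => (ω i).2) ∂(M.jointN n) := by
  rw [← integral_const_mul, ← integral_const_mul,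
    ← integral_add (hL₁.const_mul _) (hL₂.const_mul _)]
  refine integral_congr_ae (ae_of_all _ fun ω => ?_)
  have := h₁ fun i => (ω i).2
  have := h₂ fun i => (ω i).2
  simp only
  rw [integral_add_measure (Integrable.of_finite.smul_measure ENNReal.ofReal_ne_top)
    (Integrable.of_finite.smul_measure ENNReal.ofReal_ne_top), integral_smul_measure,
    integral_smul_measure, ENNReal.toReal_ofReal hc₁, ENNReal.toReal_ofReal hc₂, smul_eq_mul,
    smul_eq_mul]

theorem isFiniteMeasure_NP {α : ℝ} (hα : 0 ≤ α) (n : ℕ) (x : Fin n → 𝒳) :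
    IsFiniteMeasure (M.NP α n x) := by
  have : ∀ i, IsProbabilityMeasure (bern (M.qNP α (x i))) := fun i =>
    isProbabilityMeasure_bern (M.threshold_mem (M.isGreatest_ustar hα).1.1 _)
  unfold NP
  infer_instance

/-- The oracle rule defined in terms of convex weights. -/
noncomputable def weightedOracle (α1 α2 l : ℝ) (n : ℕ) :
    (Fin n → 𝒳) → Measure (Fin n → Bool) := fun x =>
  ENNReal.ofReal l • M.NP α1 n x + ENNReal.ofReal (1 - l) • M.NP α2 n x

theorem oracle_eq_weightedOracle {α α1 α2 l : ℝ} (h : α1 < α2)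
    (hl : l * α1 + (1 - l) * α2 = α) (n : ℕ) :
    M.oracle α α1 α2 n = M.weightedOracle α1 α2 l n := by
  have hne : α2 - α1 ≠ 0 := (sub_pos.2 h).ne'
  have e1 : (α2 - α) / (α2 - α1) = l := by
    rw [div_eq_iff hne]
    linarith
  have e2 : (α - α1) / (α2 - α1) = 1 - l := by
    rw [div_eq_iff hne]
    linarith
  rw [oracle, if_neg h.ne, e1, e2]
  rfl

end Model

/-- **Asymptotically optimal FDR control** (Theorem 1, second part). For any `α ∈ [0,1]`
there are `0 ≤ α1 ≤ α ≤ α2 ≤ 1` such that the randomized oracle rule, mixing the two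
Neyman–Pearson rules `δ^n_NP(α1)` and `δ^n_NP(α2)`, has `FDR ≤ α` for every `n` and its FNR
converges to the greatest convex minorant of `mFNR*` evaluated at `α`. -/
theorem oracle_achieves_gcm {𝒳 : Type*} [MeasurableSpace 𝒳] (M : Model 𝒳) :
    ∀ α ∈ Set.Icc (0 : ℝ) 1, ∃ α1 α2 : ℝ,
      0 ≤ α1 ∧ α1 ≤ α ∧ α ≤ α2 ∧ α2 ≤ 1 ∧
      (∀ n : ℕ, M.FDR n (M.oracle α α1 α2 n) ≤ α) ∧
      Filter.Tendsto (fun n => M.FNR n (M.oracle α α1 α2 n)) Filter.atTop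
        (nhds (gcm M.mFNRstar α)) := by
  intro α hα
  have hlsc : LowerSemicontinuousOn M.mFNRstar (Set.Icc 0 1) := by
    intro t ht y hy
    rw [M.mFNRstar_eq ht.1] at hy
    filter_upwards [M.lowerSemicontinuousOn_b_ustar t ht y hy, self_mem_nhdsWithin] with r hr hrI
    rw [M.mFNRstar_eq hrI.1]
    exact hr
  have h0 : ∀ t ∈ Set.Icc (0 : ℝ) 1, 0 ≤ M.mFNRstar t := fun t ht => by
    rw [M.mFNRstar_eq ht.1]
    exact M.b_nonneg (M.isGreatest_ustar ht.1).1.1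
  have h1 : M.mFNRstar 1 = 0 := by
    rw [M.mFNRstar_eq zero_le_one, M.ustar_one, M.b_one]
  obtain ⟨s, hs, t, ht, l, hl, hlα, hgcm⟩ := exists_gcm_eq_two_point hlsc h0 h1 hα
  refine ⟨s, t, hs.1, hs.2, ht.1, ht.2, ?_⟩
  have ht0 : 0 ≤ t := hα.1.trans ht.1
  have hl1 : 0 ≤ 1 - l := sub_nonneg.2 hl.2
  rcases eq_or_lt_of_le (hs.2.trans ht.1) with hst | hst
  · have hsα : s = α := le_antisymm hs.2 (hst ▸ ht.1)
    have ho : ∀ n, M.oracle α s t n = M.NP α n := fun n => if_pos hst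
    simp_rw [ho]
    refine ⟨M.FDR_NP_le hα.1, ?_⟩
    have hg : gcm M.mFNRstar α = M.mFNRstar α := by
      rw [hgcm, ← hst, hsα]
      ring
    rw [hg]
    exact M.tendsto_FNR_NP hα.1
  · simp_rw [M.oracle_eq_weightedOracle hst hlα]
    have hFDR : ∀ n, M.FDR n (M.weightedOracle s t l n) =
        l * M.FDR n (M.NP s n) + (1 - l) * M.FDR n (M.NP t n) := fun n =>
      M.integral_mixture (M.isFiniteMeasure_NP hs.1 n) (M.isFiniteMeasure_NP ht0 n) hl.1 hl1 FDP
        (M.integral_FDP_NP hs.1 n).1 (M.integral_FDP_NP ht0 n).1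
    have hFNR : ∀ n, M.FNR n (M.weightedOracle s t l n) =
        l * M.FNR n (M.NP s n) + (1 - l) * M.FNR n (M.NP t n) := fun n =>
      M.integral_mixture (M.isFiniteMeasure_NP hs.1 n) (M.isFiniteMeasure_NP ht0 n) hl.1 hl1 FNP
        (M.integral_FNP_NP hs.1 n).1 (M.integral_FNP_NP ht0 n).1
    simp_rw [hFDR, hFNR]
    constructor
    · intro n
      rw [← hlα]
      exact add_le_add (mul_le_mul_of_nonneg_left (M.FDR_NP_le hs.1 n) hl.1)
        (mul_le_mul_of_nonneg_left (M.FDR_NP_le ht0 n) hl1)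
    · rw [hgcm]
      exact ((M.tendsto_FNR_NP hs.1).const_mul l).add ((M.tendsto_FNR_NP ht0).const_mul (1 - l))

end TwoGroup
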